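/- arXiv:1205.6395 — 4 statements merged into one kernel-verified Lean document; each statement's English description precedes it below -/
import Mathlib

section
/- If a t-(v,k,λ) directed design D = (V,B) contains m directed trades T^1, ..., T^m whose positive parts T1^1, ..., T1^m are pairwise disjoint sub-multisets of B, then every defining set of D contains at least m blocks. -/
open scoped Classical

/-- A block of size `k` on the point set `α`: a list of `k` distinct points. -/
def IsBlock {α : Type*} (k : ℕ) (b : List α) : Prop :=
  b.Nodup ∧ b.length = k

/-- A `t-(v,k,λ)` directed design whose point set is the whole (finite) type `α`
(so `v = Fintype.card α`): every ordered `t`-tuple of distinct points appears,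
as a subsequence, in exactly `lam` blocks of the multiset `B`. -/
def IsDD {α : Type*} (t k lam : ℕ) (B : Multiset (List α)) : Prop :=
  (∀ b ∈ B, IsBlock k b) ∧
    ∀ s : List α, s.Nodup → s.length = t →
      B.countP (fun b => s.Sublist b) = lam

/-- `S` is a defining set of the `t-(v,k,λ)` directed design with block multiset `B`:
`S` is a sub-multiset of `B`, and `B` is the unique block multiset of a
`t-(v,k,λ)DD` on the same point set containing `S`. -/
def IsDefiningSet {α : Type*} (t k lam : ℕ) (B S : Multiset (List α)) : Prop :=
  S ≤ B ∧ ∀ B' : Multiset (List α), IsDD t k lam B' → S ≤ B' → B' = B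

/-- A `(v,k,t)` directed trade `T₁ - T₂` of volume `s` on the point set `α`. -/
def IsTrade {α : Type*} (t k s : ℕ) (T₁ T₂ : Multiset (List α)) : Prop :=
  1 ≤ s ∧ Multiset.card T₁ = s ∧ Multiset.card T₂ = s ∧
    (∀ b ∈ T₁, IsBlock k b) ∧ (∀ b ∈ T₂, IsBlock k b) ∧
    (∀ b, b ∈ T₁ → b ∉ T₂) ∧
    ∀ l : List α, l.Nodup → l.length = t →
      T₁.countP (fun b => l.Sublist b) = T₂.countP (fun b => l.Sublist b)

/-- A multiset of blocks is super-simple if any two blocks (any sub-multiset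
consisting of two blocks) intersect, as point sets, in at most two points. -/
def SuperSimple {α : Type*} (B : Multiset (List α)) : Prop :=
  ∀ b₁ b₂ : List α, ({b₁, b₂} : Multiset (List α)) ≤ B →
    (b₁.toFinset ∩ b₂.toFinset).card ≤ 2

/-- A `2-(v,K,1)` design (pairwise balanced design) on the point type `β`. -/
def IsPBD {β : Type*} (K : Set ℕ) (D : Multiset (Finset β)) : Prop :=
  (∀ b ∈ D, b.card ∈ K) ∧
    ∀ x y : β, x ≠ y → D.countP (fun b => x ∈ b ∧ y ∈ b) = 1

/-- A `{K}`-GDD on the point type `β` with group multiset `Gs` and block multiset `Bs`. -/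
def IsGDD {β : Type*} (K : Set ℕ) (Gs Bs : Multiset (Finset β)) : Prop :=
  (∀ x : β, Gs.countP (fun G => x ∈ G) = 1) ∧
    (∀ b ∈ Bs, b.card ∈ K) ∧
    (∀ b ∈ Bs, ∀ G ∈ Gs, (b ∩ G).card ≤ 1) ∧
    (∀ x y : β, x ≠ y → (∀ G ∈ Gs, ¬(x ∈ G ∧ y ∈ G)) →
      Bs.countP (fun b => x ∈ b ∧ y ∈ b) = 1)

/-- A `4`-DGDD on the point type `β` with group multiset `Gs` and block multiset `B`:
the groups partition the points, no block meets a group twice, and every ordered pair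
of points from distinct groups appears in exactly one block. -/
def IsDGDD {β : Type*} (Gs : Multiset (Finset β)) (B : Multiset (List β)) : Prop :=
  (∀ x : β, Gs.countP (fun G => x ∈ G) = 1) ∧
    (∀ b ∈ B, IsBlock 4 b) ∧
    (∀ b ∈ B, ∀ G ∈ Gs, (b.toFinset ∩ G).card ≤ 1) ∧
    (∀ x y : β, x ≠ y → (∀ G ∈ Gs, ¬(x ∈ G ∧ y ∈ G)) →
      B.countP (fun b => [x, y].Sublist b) = 1)

/-- `S` is a defining set of the `4`-DGDD with groups `Gs` and block multiset `B`. -/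
def IsDGDDDefiningSet {β : Type*} (Gs : Multiset (Finset β)) (B S : Multiset (List β)) : Prop :=
  S ≤ B ∧ ∀ B' : Multiset (List β), IsDGDD Gs B' → S ≤ B' → B' = B

/-- If the positive part of a trade lies in a directed design, swapping it for the
negative part yields a directed design with the same parameters. -/
lemma IsDD.sub_add_trade {α : Type*} {t k lam s : ℕ} {B T₁ T₂ : Multiset (List α)}
    (hB : IsDD t k lam B) (hT : IsTrade t k s T₁ T₂) (hsub : T₁ ≤ B) :
    IsDD t k lam (B - T₁ + T₂) := by
  obtain ⟨-, -, -, -, hblock, -, hcount⟩ := hT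
  refine ⟨fun b hb => ?_, fun l hl hlt => ?_⟩
  · rcases Multiset.mem_add.1 hb with hb | hb
    · exact hB.1 b (Multiset.mem_of_le (Multiset.sub_le_self _ _) hb)
    · exact hblock b hb
  · rw [Multiset.countP_add, ← hcount l hl hlt, ← Multiset.countP_add,
      Multiset.sub_add_cancel hsub]
    exact hB.2 l hl hlt

/-- A defining set meets the positive part of every trade contained in the design. -/
lemma IsDefiningSet.exists_mem_trade {α : Type*} {t k lam s : ℕ}
    {B S T₁ T₂ : Multiset (List α)} (hB : IsDD t k lam B) (hS : IsDefiningSet t k lam B S)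
    (hT : IsTrade t k s T₁ T₂) (hsub : T₁ ≤ B) : ∃ b ∈ T₁, b ∈ S := by
  by_contra! h
  have hle : S ≤ B - T₁ := by
    rw [Multiset.le_iff_count]
    intro b
    rw [Multiset.count_sub]
    by_cases hb : b ∈ T₁
    · simp [Multiset.count_eq_zero_of_notMem (h b hb)]
    · simpa [Multiset.count_eq_zero_of_notMem hb] using Multiset.le_iff_count.1 hS.1 b
  have heq := hS.2 _ (hB.sub_add_trade hT hsub) (hle.trans (Multiset.le_add_right _ _))
  have hTT : T₂ = T₁ := add_left_cancel (heq.trans (Multiset.sub_add_cancel hsub).symm)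
  obtain ⟨hs, hcard, -, -, -, hdisj, -⟩ := hT
  obtain ⟨b, hb⟩ := Multiset.card_pos_iff_exists_mem.1 (show 0 < Multiset.card T₁ by omega)
  exact hdisj b hb (hTT ▸ hb)

/-- If a `t-(v,k,λ)` directed design contains `m` directed trades
whose positive parts are pairwise disjoint sub-multisets of `B`, then every
defining set has at least `m` blocks. -/
theorem stmt1 {α : Type*} [Fintype α] {v t k lam m : ℕ} (hv : Fintype.card α = v)
    (B : Multiset (List α)) (hB : IsDD t k lam B)
    (s : Fin m → ℕ) (T₁ T₂ : Fin m → Multiset (List α))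
    (htrade : ∀ i, IsTrade t k (s i) (T₁ i) (T₂ i))
    (hsub : ∀ i, T₁ i ≤ B)
    (hdisj : ∀ i j, i ≠ j → ∀ b, b ∈ T₁ i → b ∉ T₁ j)
    (S : Multiset (List α)) (hS : IsDefiningSet t k lam B S) :
    m ≤ Multiset.card S := by
  choose f hfT hfS using fun i => hS.exists_mem_trade hB (htrade i) (hsub i)
  have hinj : Function.Injective f := fun i j hij => by
    by_contra hne
    exact hdisj i j hne (f i) (hfT i) (hij ▸ hfT j)
  calc m = (Finset.univ.image f).card := by simp [Finset.card_image_of_injective _ hinj]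
    _ ≤ S.toFinset.card := Finset.card_le_card fun b hb => by
        obtain ⟨i, -, rfl⟩ := Finset.mem_image.1 hb
        exact Multiset.mem_toFinset.2 (hfS i)
    _ ≤ Multiset.card S := Multiset.toFinset_card_le S
end

section
/- Let K be a set of integers and let c ≥ 0 be a real constant. If there exists a 2-(v,K,1) design and, for each k ∈ K, a super-simple 2-(k,4,1) directed design whose smallest defining sets contain at least c times its number of blocks, then there exists a super-simple 2-(v,4,1) directed design whose smallest defining sets contain at least c times its number of blocks. (In particular, taking c = 0: a 2-(v,K,1) design together with a super-simple 2-(k,4,1)DD for each k ∈ K yields a super-simple 2-(v,4,1)DD.) -/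
open scoped Classical

/-- `A` is a `2-(|d|,4,1)` directed design on the subset `d` of the points. -/
def IsDDOn {β : Type*} (d : Finset β) (A : Multiset (List β)) : Prop :=
  (∀ b ∈ A, IsBlock 4 b) ∧ (∀ b ∈ A, ∀ x ∈ b, x ∈ d) ∧
    ∀ x y : β, x ≠ y →
      A.countP (fun b => [x, y].Sublist b) = if x ∈ d ∧ y ∈ d then 1 else 0

theorem List.pair_sublist_map_iff {α β : Type*} {e : α → β} (he : Function.Injective e)
    (i j : α) (l : List α) : [e i, e j].Sublist (l.map e) ↔ [i, j].Sublist l := by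
  constructor
  · intro h
    obtain ⟨l', hl', h'⟩ := List.sublist_map_iff.1 h
    have : [i, j] = l' := List.map_injective_iff.2 he (by simpa using h')
    exact this ▸ hl'
  · intro h
    simpa using h.map e

theorem isDD_two_iff {β : Type*} {B : Multiset (List β)} :
    IsDD 2 4 1 B ↔ (∀ b ∈ B, IsBlock 4 b) ∧
      ∀ x y : β, x ≠ y → B.countP (fun b => [x, y].Sublist b) = 1 := by
  refine and_congr_right fun _ => ⟨fun h x y hxy => h [x, y] (by simpa using hxy) rfl, ?_⟩
  intro h s hs hl
  obtain ⟨x, y, rfl⟩ := List.length_eq_two.1 hl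
  exact h x y (by simpa using hs)

theorem IsDD.isDDOn_map {α β : Type*} {B : Multiset (List α)} (hB : IsDD 2 4 1 B)
    {e : α → β} (he : Function.Injective e) {d : Finset β} (hd : Set.range e = d) :
    IsDDOn d (B.map (List.map e)) := by
  have hmem : ∀ x, x ∈ d ↔ ∃ i, e i = x := fun x => by
    rw [← Finset.mem_coe, ← hd, Set.mem_range]
  rw [isDD_two_iff] at hB
  have hsub : ∀ b ∈ B.map (List.map e), ∀ x ∈ b, x ∈ d := by
    intro b hb x hx
    obtain ⟨l, -, rfl⟩ := Multiset.mem_map.1 hb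
    obtain ⟨i, -, rfl⟩ := List.mem_map.1 hx
    exact (hmem _).2 ⟨i, rfl⟩
  refine ⟨?_, hsub, ?_⟩
  · intro b hb
    obtain ⟨l, hl, rfl⟩ := Multiset.mem_map.1 hb
    exact ⟨(hB.1 l hl).1.map he, by simpa using (hB.1 l hl).2⟩
  · intro x y hxy
    split_ifs with h
    · obtain ⟨i, rfl⟩ := (hmem x).1 h.1
      obtain ⟨j, rfl⟩ := (hmem y).1 h.2
      rw [Multiset.countP_map, ← Multiset.countP_eq_card_filter]
      simp only [List.pair_sublist_map_iff he]
      exact hB.2 i j fun hij => hxy (hij ▸ rfl)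
    · rw [Multiset.countP_eq_zero]
      intro b hb hs
      exact h ⟨hsub b hb x (hs.subset (by simp)), hsub b hb y (hs.subset (by simp))⟩

theorem SuperSimple.map {α β : Type*} {B : Multiset (List α)} (hB : SuperSimple B) {e : α → β}
    (he : Function.Injective e) : SuperSimple (B.map (List.map e)) := by
  intro b₁ b₂ h
  obtain ⟨l₁, -, rfl⟩ := Multiset.mem_map.1 (Multiset.mem_of_le h (by simp : b₁ ∈ _))
  obtain ⟨l₂, -, rfl⟩ := Multiset.mem_map.1 (Multiset.mem_of_le h (by simp : b₂ ∈ _))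
  have h' : ({l₁, l₂} : Multiset (List α)) ≤ B :=
    (Multiset.map_le_map_iff (List.map_injective_iff.2 he)).1 (by simpa using h)
  refine le_trans ?_ (hB l₁ l₂ h')
  rw [← Finset.card_image_of_injective _ he]
  refine Finset.card_le_card fun x hx => ?_
  simp only [Finset.mem_inter, List.mem_toFinset, List.mem_map, Finset.mem_image] at hx ⊢
  obtain ⟨⟨i, hi, rfl⟩, j, hj, hij⟩ := hx
  exact ⟨i, ⟨hi, he hij ▸ hj⟩, rfl⟩

theorem IsDD.nodup {β : Type*} {B : Multiset (List β)} (hB : IsDD 2 4 1 B) : B.Nodup := by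
  rw [isDD_two_iff] at hB
  rw [Multiset.nodup_iff_le]
  intro b hb
  have hblock := hB.1 b (Multiset.mem_of_le hb (by simp))
  obtain ⟨hnd, hlen⟩ := hblock
  match b, hlen, hnd, hb with
  | [w, x, y, z], _, hnd, hb =>
    have hwx : w ≠ x := by simp at hnd; tauto
    have h1 := Multiset.countP_le_of_le (fun b => [w, x].Sublist b) hb
    rw [hB.2 w x hwx, Multiset.countP_cons_of_pos _ (by simp),
      Multiset.countP_cons_of_pos _ (by simp)] at h1
    omega

theorem IsDDOn.isDD_replace {β : Type*} {d : Finset β} {A₁ A₂ R : Multiset (List β)}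
    (h₁ : IsDDOn d A₁) (h₂ : IsDDOn d A₂) (h : IsDD 2 4 1 (A₁ + R)) : IsDD 2 4 1 (A₂ + R) := by
  rw [isDD_two_iff] at h ⊢
  refine ⟨fun b hb => ?_, fun x y hxy => ?_⟩
  · rcases Multiset.mem_add.1 hb with hb | hb
    · exact h₂.1 b hb
    · exact h.1 b (Multiset.mem_add.2 (Or.inr hb))
  · rw [← h.2 x y hxy, Multiset.countP_add, Multiset.countP_add, h₁.2.2 x y hxy, h₂.2.2 x y hxy]

theorem IsPBD.isDD_bind {β : Type*} {K : Set ℕ} {D : Multiset (Finset β)} (hD : IsPBD K D)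
    {f : Finset β → Multiset (List β)} (hf : ∀ d ∈ D, IsDDOn d (f d)) :
    IsDD 2 4 1 (D.bind f) := by
  rw [isDD_two_iff]
  refine ⟨fun b hb => ?_, fun x y hxy => ?_⟩
  · obtain ⟨d, hd, hb⟩ := Multiset.mem_bind.1 hb
    exact (hf d hd).1 b hb
  · rw [← hD.2 x y hxy]
    clear hD
    induction D using Multiset.induction_on with
    | empty => simp
    | cons d D ih =>
      rw [Multiset.cons_bind, Multiset.countP_add, ih fun d hd => hf d (Multiset.mem_cons_of_mem hd),
        (hf d (Multiset.mem_cons_self d D)).2.2 x y hxy, Multiset.countP_cons, add_comm]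

theorem IsPBD.eq_of_mem {β : Type*} {K : Set ℕ} {D : Multiset (Finset β)} (hD : IsPBD K D)
    {x y : β} (hxy : x ≠ y) {d₁ d₂ : Finset β} (h₁ : d₁ ∈ D) (h₂ : d₂ ∈ D)
    (hd₁ : x ∈ d₁ ∧ y ∈ d₁) (hd₂ : x ∈ d₂ ∧ y ∈ d₂) : d₁ = d₂ := by
  have h := hD.2 x y hxy
  rw [Multiset.countP_eq_card_filter] at h
  obtain ⟨d, hd⟩ := Multiset.card_eq_one.1 h
  have e₁ : d₁ ∈ ({d} : Multiset (Finset β)) := hd ▸ Multiset.mem_filter.2 ⟨h₁, hd₁⟩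
  have e₂ : d₂ ∈ ({d} : Multiset (Finset β)) := hd ▸ Multiset.mem_filter.2 ⟨h₂, hd₂⟩
  rw [Multiset.mem_singleton] at e₁ e₂
  rw [e₁, e₂]

theorem IsPBD.superSimple_bind {β : Type*} {K : Set ℕ} {D : Multiset (Finset β)}
    (hD : IsPBD K D) {f : Finset β → Multiset (List β)} (hf : ∀ d ∈ D, IsDDOn d (f d))
    (hs : ∀ d ∈ D, SuperSimple (f d)) : SuperSimple (D.bind f) := by
  intro b₁ b₂ h
  have hne : b₁ ≠ b₂ := by
    rintro rfl
    exact Multiset.nodup_iff_le.1 (hD.isDD_bind hf).nodup b₁ h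
  obtain ⟨d₁, hd₁, hb₁⟩ := Multiset.mem_bind.1 (Multiset.mem_of_le h (by simp : b₁ ∈ _))
  obtain ⟨d₂, hd₂, hb₂⟩ := Multiset.mem_bind.1 (Multiset.mem_of_le h (by simp : b₂ ∈ _))
  by_contra! hcard
  obtain ⟨x, hx, y, hy, hxy⟩ := Finset.one_lt_card.1 (lt_trans one_lt_two hcard)
  simp only [Finset.mem_inter, List.mem_toFinset] at hx hy
  obtain rfl : d₁ = d₂ := hD.eq_of_mem hxy hd₁ hd₂
    ⟨(hf d₁ hd₁).2.1 b₁ hb₁ x hx.1, (hf d₁ hd₁).2.1 b₁ hb₁ y hy.1⟩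
    ⟨(hf d₂ hd₂).2.1 b₂ hb₂ x hx.2, (hf d₂ hd₂).2.1 b₂ hb₂ y hy.2⟩
  have hle : ({b₁, b₂} : Multiset (List β)) ≤ f d₁ := by
    rw [Multiset.le_iff_subset (by simpa using hne)]
    intro b hb
    simp only [Multiset.insert_eq_cons, Multiset.mem_cons, Multiset.mem_singleton] at hb
    rcases hb with rfl | rfl <;> assumption
  exact absurd (hs d₁ hd₁ b₁ b₂ hle) (by omega)

theorem Multiset.Nodup.filter_mem_eq {α : Type*} {B S : Multiset α} [DecidablePred (· ∈ S)]
    (hB : B.Nodup) (h : S ≤ B) :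
    B.filter (· ∈ S) = S := by
  refine (Multiset.Nodup.ext (hB.filter _) (Multiset.nodup_of_le h hB)).2 fun a => ?_
  rw [Multiset.mem_filter]
  exact ⟨And.right, fun ha => ⟨Multiset.mem_of_le h ha, ha⟩⟩

/-- A defining set restricts to a defining set of a sub-design. -/
theorem IsDefiningSet.restrict {α β : Type*} {A : Multiset (List α)} {R S : Multiset (List β)}
    {e : α → β} (he : Function.Injective e) {d : Finset β} (hd : Set.range e = d)
    (hA : IsDD 2 4 1 A) (hB : IsDD 2 4 1 (A.map (List.map e) + R))
    (hS : IsDefiningSet 2 4 1 (A.map (List.map e) + R) S) :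
    IsDefiningSet 2 4 1 A (A.filter fun l => l.map e ∈ S) := by
  refine ⟨Multiset.filter_le _ _, fun A' hA' hle => ?_⟩
  have hEq := hS.2 (A'.map (List.map e) + R)
    ((hA.isDDOn_map he hd).isDD_replace (hA'.isDDOn_map he hd) hB) (by
      rw [← hB.nodup.filter_mem_eq hS.1, Multiset.filter_add, Multiset.filter_map]
      refine add_le_add (Multiset.map_le_map (le_of_eq_of_le ?_ hle)) (Multiset.filter_le _ _)
      exact Multiset.filter_congr fun _ _ => Iff.rfl)
  exact Multiset.map_injective (List.map_injective_iff.2 he) (add_right_cancel hEq)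

theorem Multiset.mul_card_bind_le {ι α : Type*} (c : ℝ) (D : Multiset ι) (f : ι → Multiset α)
    (p : α → Prop) [DecidablePred p]
    (h : ∀ d ∈ D, c * (Multiset.card (f d) : ℝ) ≤ Multiset.card ((f d).filter p)) :
    c * (Multiset.card (D.bind f) : ℝ) ≤ Multiset.card ((D.bind f).filter p) := by
  induction D using Multiset.induction_on with
  | empty => simp
  | cons d D ih =>
    have h₁ := h d (Multiset.mem_cons_self d D)
    have h₂ := ih fun d hd => h d (Multiset.mem_cons_of_mem hd)
    rw [Multiset.cons_bind, Multiset.filter_add, Multiset.card_add, Multiset.card_add]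
    push_cast
    linarith

/-- If there is a `2-(v,K,1)` design and, for each `k ∈ K`, a
super-simple `2-(k,4,1)DD` all of whose defining sets have at least `c` times its
number of blocks, then there is a super-simple `2-(v,4,1)DD` all of whose defining
sets have at least `c` times its number of blocks. -/
theorem stmt3 (K : Set ℕ) (c : ℝ) (hc : 0 ≤ c) (v : ℕ)
    (hPBD : ∃ D : Multiset (Finset (Fin v)), IsPBD K D)
    (hDD : ∀ k ∈ K, ∃ B : Multiset (List (Fin k)),
      IsDD 2 4 1 B ∧ SuperSimple B ∧
      ∀ S : Multiset (List (Fin k)), IsDefiningSet 2 4 1 B S →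
        c * (Multiset.card B : ℝ) ≤ (Multiset.card S : ℝ)) :
    ∃ B : Multiset (List (Fin v)),
      IsDD 2 4 1 B ∧ SuperSimple B ∧
      ∀ S : Multiset (List (Fin v)), IsDefiningSet 2 4 1 B S →
        c * (Multiset.card B : ℝ) ≤ (Multiset.card S : ℝ) := by
  obtain ⟨D, hD⟩ := hPBD
  have hDD' : ∀ k, ∃ B : Multiset (List (Fin k)), k ∈ K → IsDD 2 4 1 B ∧ SuperSimple B ∧
      ∀ S : Multiset (List (Fin k)), IsDefiningSet 2 4 1 B S →
        c * (Multiset.card B : ℝ) ≤ (Multiset.card S : ℝ) := by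
    intro k
    by_cases hk : k ∈ K
    · obtain ⟨B, hB⟩ := hDD k hk
      exact ⟨B, fun _ => hB⟩
    · exact ⟨0, fun h => absurd h hk⟩
  choose A hA using hDD'
  let e : ∀ d : Finset (Fin v), Fin d.card → Fin v := fun d => d.orderEmbOfFin rfl
  have he : ∀ d, Function.Injective (e d) := fun d => (d.orderEmbOfFin rfl).injective
  have hrange : ∀ d : Finset (Fin v), Set.range (e d) = d := fun d => d.range_orderEmbOfFin rfl
  let f : Finset (Fin v) → Multiset (List (Fin v)) := fun d => (A d.card).map (List.map (e d))
  have hf : ∀ d ∈ D, IsDDOn d (f d) := fun d hd =>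
    (hA _ (hD.1 d hd)).1.isDDOn_map (he d) (hrange d)
  have hB : IsDD 2 4 1 (D.bind f) := hD.isDD_bind hf
  refine ⟨D.bind f, hB,
    hD.superSimple_bind hf fun d hd => (hA _ (hD.1 d hd)).2.1.map (he d), fun S hS => ?_⟩
  rw [← hB.nodup.filter_mem_eq hS.1]
  refine Multiset.mul_card_bind_le c D f (· ∈ S) fun d hd => ?_
  obtain ⟨D', rfl⟩ := Multiset.exists_cons_of_mem hd
  rw [Multiset.cons_bind] at hB hS
  have hdk := hA _ (hD.1 d hd)
  have h := hdk.2.2 _ (hS.restrict (he d) (hrange d) hdk.1 hB)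
  rw [Multiset.filter_map, Multiset.card_map, Multiset.card_map]
  convert h
  rfl
end

section
/- Let K be a set of integers, α a positive integer, and c ≥ 0 a real constant. Suppose there exists a {K}-GDD of type g1^{u1} g2^{u2} ··· gN^{uN}; suppose that for each i = 1, ..., N there exists a super-simple 2-(α·g_i + 1, 4, 1) directed design whose smallest defining sets contain at least c times its number of blocks; and suppose that for each k ∈ K there exists a super-simple 4-DGDD of type α^k whose smallest defining sets contain at least c times its number of blocks. Then there exists a super-simple 2-(α·(g1·u1 + ··· + gN·uN) + 1, 4, 1) directed design whose smallest defining sets contain at least c times its number of blocks. -/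
open scoped Classical

/-- The blocks of `B` have size four and cover exactly once each ordered pair of distinct points
related by `R`, and no other pair. -/
def IsPairDesign {α : Type*} (R : α → α → Prop) (B : Multiset (List α)) : Prop :=
  (∀ b ∈ B, IsBlock 4 b) ∧
    ∀ x y : α, x ≠ y → B.countP (fun b => [x, y].Sublist b) = if R x y then 1 else 0

/-- There is a super-simple pair design for `R` all of whose defining sets contain
at least `c` times its number of blocks. -/
def HasSuperSimplePairDesign {α : Type*} (c : ℝ) (R : α → α → Prop) : Prop :=
  ∃ B : Multiset (List α), IsPairDesign R B ∧ SuperSimple B ∧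
    ∀ S ≤ B, (∀ B', IsPairDesign R B' → S ≤ B' → B' = B) →
      c * (Multiset.card B : ℝ) ≤ (Multiset.card S : ℝ)

theorem List.pair_sublist_or_of_mem {α : Type*} {x y : α} (hxy : x ≠ y) {l : List α}
    (hx : x ∈ l) (hy : y ∈ l) : [x, y].Sublist l ∨ [y, x].Sublist l := by
  induction l with
  | nil => simp at hx
  | cons a l ih =>
    rcases List.mem_cons.1 hx with rfl | hx
    · rcases List.mem_cons.1 hy with rfl | hy
      · exact absurd rfl hxy
      · exact Or.inl ((List.singleton_sublist.2 hy).cons_cons _)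
    · rcases List.mem_cons.1 hy with e | hy
      · rw [e]
        exact Or.inr ((List.singleton_sublist.2 hx).cons_cons _)
      · exact (ih hx hy).imp (List.Sublist.cons _) (List.Sublist.cons _)

theorem Multiset.existsUnique_of_countP_eq_one {α : Type*} [DecidableEq α] {m : Multiset α} {p : α → Prop}
    [DecidablePred p] (h : m.countP p = 1) : ∃! i : m, p i.1 := by
  rw [← m.map_univ_coe, Multiset.countP_map] at h
  change (Finset.univ.filter fun i : m => p i.1).card = 1 at h
  obtain ⟨i, hi⟩ := Finset.card_eq_one.1 h
  refine ⟨i, by simpa using (Finset.ext_iff.1 hi i), fun j hj => ?_⟩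
  simpa [hj] using Finset.ext_iff.1 hi j

theorem Multiset.countP_finset_sum {ι α : Type*} (p : α → Prop) [DecidablePred p] (s : Finset ι)
    (F : ι → Multiset α) : (∑ j ∈ s, F j).countP p = ∑ j ∈ s, (F j).countP p :=
  map_sum (Multiset.countPAddMonoidHom p) F s

theorem Multiset.exists_sum_eq_of_le_sum {ι α : Type*} (s : Finset ι) (F : ι → Multiset α) :
    ∀ S ≤ ∑ j ∈ s, F j, ∃ T : ι → Multiset α, (∀ j, T j ≤ F j) ∧ S = ∑ j ∈ s, T j := by
  induction s using Finset.induction_on with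
  | empty =>
    intro S hS
    exact ⟨fun _ => 0, fun _ => Multiset.zero_le _, by simpa using hS⟩
  | insert a s ha ih =>
    intro S hS
    rw [Finset.sum_insert ha] at hS
    obtain ⟨T, hT, hST⟩ := ih (S - F a) (by rwa [Multiset.sub_le_iff_le_add'])
    refine ⟨Function.update T a (S ∩ F a), fun j => ?_, ?_⟩
    · by_cases hj : j = a
      · subst hj; simpa using Multiset.inter_le_right
      · simpa [hj] using hT j
    · rw [Finset.sum_insert ha, Function.update_self,
        Finset.sum_congr rfl fun j hj => Function.update_of_ne (ne_of_mem_of_not_mem hj ha) _ _,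
        ← hST, add_comm, Multiset.sub_add_inter]

namespace IsPairDesign

variable {α β : Type*} {R : α → α → Prop} {B : Multiset (List α)}

theorem rel_of_sublist (h : IsPairDesign R B) {b : List α} (hb : b ∈ B) {x y : α}
    (hs : [x, y].Sublist b) : R x y := by
  have hxy : x ≠ y := by simpa using hs.nodup (h.1 b hb).1
  by_contra hR
  have := h.2 x y hxy
  rw [if_neg hR, Multiset.countP_eq_zero] at this
  exact this b hb hs

theorem exists_pair_sublist (h : IsPairDesign R B) {b : List α} (hb : b ∈ B) :
    ∃ x y, x ≠ y ∧ [x, y].Sublist b := by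
  obtain ⟨hn, hl⟩ := h.1 b hb
  match b, hl with
  | x :: y :: l, _ =>
    exact ⟨x, y, by rintro rfl; simp at hn, ((List.nil_sublist l).cons_cons y).cons_cons x⟩

theorem nodup (h : IsPairDesign R B) : B.Nodup := by
  rw [Multiset.nodup_iff_count_le_one]
  intro b
  by_cases hb : b ∈ B
  · obtain ⟨x, y, hxy, hs⟩ := h.exists_pair_sublist hb
    calc B.count b ≤ B.countP (fun b => [x, y].Sublist b) := by
          rw [Multiset.count, Multiset.countP_eq_card_filter, Multiset.countP_eq_card_filter]
          exact Multiset.card_le_card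
            (Multiset.monotone_filter_right _ fun a ha => by subst ha; exact hs)
      _ ≤ 1 := by rw [h.2 x y hxy]; split <;> simp
  · simp [Multiset.count_eq_zero_of_notMem hb]

theorem superSimple_iff (h : IsPairDesign R B) : SuperSimple B ↔
    ∀ b₁ ∈ B, ∀ b₂ ∈ B, b₁ ≠ b₂ → (b₁.toFinset ∩ b₂.toFinset).card ≤ 2 := by
  refine ⟨fun hs b₁ h₁ b₂ h₂ hne => hs b₁ b₂ ?_, fun hs b₁ b₂ hle => ?_⟩
  · rw [Multiset.le_iff_subset (by simpa using hne)]
    intro b hb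
    simp only [Multiset.insert_eq_cons, Multiset.mem_cons, Multiset.mem_singleton] at hb
    rcases hb with rfl | rfl <;> assumption
  · have hne : b₁ ≠ b₂ := by simpa using Multiset.nodup_of_le hle h.nodup
    exact hs b₁ (Multiset.mem_of_le hle (by simp)) b₂ (Multiset.mem_of_le hle (by simp)) hne

theorem map (h : IsPairDesign R B) {f : α → β} (hf : Function.Injective f) {R' : β → β → Prop}
    (hR : ∀ a b, R a b ↔ R' (f a) (f b))
    (hR' : ∀ x y, R' x y → x ∈ Set.range f ∧ y ∈ Set.range f) :
    IsPairDesign R' (B.map (List.map f)) := by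
  refine ⟨fun b hb => ?_, fun x y hxy => ?_⟩
  · obtain ⟨a, ha, rfl⟩ := Multiset.mem_map.1 hb
    exact ⟨(h.1 a ha).1.map hf, by simpa using (h.1 a ha).2⟩
  · by_cases hr : x ∈ Set.range f ∧ y ∈ Set.range f
    · obtain ⟨⟨a, rfl⟩, ⟨b, rfl⟩⟩ := hr
      have hab : a ≠ b := fun e => hxy (congrArg f e)
      have key : ∀ l : List α, [f a, f b].Sublist (l.map f) ↔ [a, b].Sublist l := by
        intro l
        rw [List.sublist_map_iff]
        constructor
        · rintro ⟨l', hl', e⟩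
          rwa [List.map_injective_iff.2 hf (show List.map f [a, b] = l'.map f from e)]
        · exact fun hl => ⟨_, hl, rfl⟩
      rw [Multiset.countP_map]
      simp only [key, ← hR]
      rw [← Multiset.countP_eq_card_filter]
      exact h.2 a b hab
    · rw [if_neg (fun e => hr (hR' x y e)), Multiset.countP_eq_zero]
      intro b hb hs
      obtain ⟨a, ha, rfl⟩ := Multiset.mem_map.1 hb
      have hx : x ∈ a.map f := hs.subset (by simp)
      have hy : y ∈ a.map f := hs.subset (by simp)
      obtain ⟨p, -, hp⟩ := List.mem_map.1 hx
      obtain ⟨q, -, hq⟩ := List.mem_map.1 hy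
      exact hr ⟨⟨p, hp⟩, ⟨q, hq⟩⟩

theorem sum {ι : Type*} [Fintype ι] {R : ι → α → α → Prop} {B : ι → Multiset (List α)}
    (hR : ∀ x y, x ≠ y → ∃! j, R j x y) (h : ∀ j, IsPairDesign (R j) (B j)) :
    IsPairDesign (· ≠ ·) (∑ j, B j) := by
  refine ⟨fun b hb => ?_, fun x y hxy => ?_⟩
  · obtain ⟨j, -, hj⟩ := Multiset.mem_sum.1 hb
    exact (h j).1 b hj
  · rw [Multiset.countP_finset_sum, Finset.sum_congr rfl fun j _ => (h j).2 x y hxy, if_pos hxy]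
    obtain ⟨j, hj, hu⟩ := hR x y hxy
    rw [Finset.sum_eq_single j (fun i _ hi => if_neg fun e => hi (hu i e)) (by simp), if_pos hj]

end IsPairDesign

theorem isDD_two_four_one_iff {α : Type*} (B : Multiset (List α)) :
    IsDD 2 4 1 B ↔ IsPairDesign (· ≠ ·) B := by
  refine and_congr_right fun _ => ⟨fun h x y hxy => ?_, fun h s hs hl => ?_⟩
  · rw [if_pos hxy]
    exact h [x, y] (by simpa using hxy) rfl
  · obtain ⟨x, y, rfl⟩ := List.length_eq_two.1 hl
    have hxy : x ≠ y := by simpa using hs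
    rw [h x y hxy, if_pos hxy]

theorem isDGDD_iff {α : Type*} {Gs : Multiset (Finset α)}
    (hGs : ∀ x : α, Gs.countP (fun G => x ∈ G) = 1) (B : Multiset (List α)) :
    IsDGDD Gs B ↔ IsPairDesign (fun x y => ∀ G ∈ Gs, ¬(x ∈ G ∧ y ∈ G)) B := by
  constructor
  · rintro ⟨-, hB, hG, h⟩
    refine ⟨hB, fun x y hxy => ?_⟩
    split_ifs with hR
    · exact h x y hxy hR
    · rw [Multiset.countP_eq_zero]
      intro b hb hs
      push Not at hR
      obtain ⟨G, hGG, hx, hy⟩ := hR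
      refine hxy (Finset.card_le_one.1 (hG b hb G hGG) x ?_ y ?_) <;>
        simp only [Finset.mem_inter, List.mem_toFinset]
      · exact ⟨hs.subset (by simp), hx⟩
      · exact ⟨hs.subset (by simp), hy⟩
  · intro h
    refine ⟨hGs, h.1, fun b hb G hG => ?_, fun x y hxy hR => by rw [h.2 x y hxy, if_pos hR]⟩
    rw [Finset.card_le_one]
    intro x hx y hy
    simp only [Finset.mem_inter, List.mem_toFinset] at hx hy
    by_contra hxy
    rcases List.pair_sublist_or_of_mem hxy hx.1 hy.1 with hs | hs
    · exact h.rel_of_sublist hb hs G hG ⟨hx.2, hy.2⟩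
    · exact h.rel_of_sublist hb hs G hG ⟨hy.2, hx.2⟩

namespace HasSuperSimplePairDesign

variable {α β : Type*} {c : ℝ}

theorem map {R : α → α → Prop} (h : HasSuperSimplePairDesign c R) {f : α → β}
    (hf : Function.Injective f) {R' : β → β → Prop} (hR : ∀ a b, R a b ↔ R' (f a) (f b))
    (hR' : ∀ x y, R' x y → x ∈ Set.range f ∧ y ∈ Set.range f) :
    HasSuperSimplePairDesign c R' := by
  obtain ⟨B, hB, hss, hdef⟩ := h
  have hfl : Function.Injective (List.map f) := List.map_injective_iff.2 hf
  refine ⟨B.map (List.map f), hB.map hf hR hR', ?_, fun S hS hu => ?_⟩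
  · rw [(hB.map hf hR hR').superSimple_iff]
    intro b₁ h₁ b₂ h₂ hne
    obtain ⟨a₁, ha₁, rfl⟩ := Multiset.mem_map.1 h₁
    obtain ⟨a₂, ha₂, rfl⟩ := Multiset.mem_map.1 h₂
    have := hB.superSimple_iff.1 hss a₁ ha₁ a₂ ha₂ (fun e => hne (by rw [e]))
    have himage : ∀ a : List α, (a.map f).toFinset = a.toFinset.image f := fun a => by ext; simp
    rwa [himage, himage, ← Finset.image_inter _ _ hf, Finset.card_image_of_injective _ hf]
  · obtain ⟨T, rfl⟩ : ∃ T : Multiset (List α), T.map (List.map f) = S := by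
      have hmem : ∀ s ∈ S, ∃ t, List.map f t = s := fun s hs => by
        obtain ⟨t, -, ht⟩ := Multiset.mem_map.1 (Multiset.mem_of_le hS hs)
        exact ⟨t, ht⟩
      clear hS hu
      induction S using Multiset.induction_on with
      | empty => exact ⟨0, rfl⟩
      | cons a S ih =>
        obtain ⟨t, ht⟩ := hmem a (by simp)
        obtain ⟨T, hT⟩ := ih fun s hs => hmem s (Multiset.mem_cons_of_mem hs)
        exact ⟨t ::ₘ T, by simp [ht, hT]⟩
    rw [Multiset.map_le_map_iff hfl] at hS
    simpa using hdef T hS fun B' hB' hT => Multiset.map_injective hfl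
      (hu _ (hB'.map hf hR hR') (Multiset.map_le_map hT))

theorem sum {ι : Type*} [Fintype ι] {R : ι → α → α → Prop}
    (hsymm : ∀ j x y, R j x y → R j y x) (hR : ∀ x y, x ≠ y → ∃! j, R j x y)
    (h : ∀ j, HasSuperSimplePairDesign c (R j)) :
    HasSuperSimplePairDesign c (fun x y : α => x ≠ y) := by
  choose B hB hss hdef using h
  have hsum := IsPairDesign.sum hR hB
  refine ⟨∑ j, B j, hsum, ?_, fun S hS hu => ?_⟩
  · rw [hsum.superSimple_iff]
    intro b₁ h₁ b₂ h₂ hne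
    obtain ⟨i, -, h₁⟩ := Multiset.mem_sum.1 h₁
    obtain ⟨j, -, h₂⟩ := Multiset.mem_sum.1 h₂
    by_cases hij : i = j
    · subst hij
      exact (hB i).superSimple_iff.1 (hss i) b₁ h₁ b₂ h₂ hne
    · refine le_trans (Finset.card_le_one.2 fun x hx y hy => ?_) one_le_two
      simp only [Finset.mem_inter, List.mem_toFinset] at hx hy
      by_contra hxy
      have hrel : ∀ k, ∀ b ∈ B k, x ∈ b → y ∈ b → R k x y := fun k b hb hxb hyb =>
        (List.pair_sublist_or_of_mem hxy hxb hyb).elim ((hB k).rel_of_sublist hb)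
          fun hs => hsymm _ _ _ ((hB k).rel_of_sublist hb hs)
      exact hij ((hR x y hxy).unique (hrel i b₁ h₁ hx.1 hy.1) (hrel j b₂ h₂ hx.2 hy.2))
  · obtain ⟨T, hT, rfl⟩ := Multiset.exists_sum_eq_of_le_sum _ _ S hS
    simp only [Multiset.card_sum, Nat.cast_sum, Finset.mul_sum]
    refine Finset.sum_le_sum fun j _ => hdef j (T j) (hT j) fun B' hB' hTB' => ?_
    have hupd : ∀ i, IsPairDesign (R i) (Function.update B j B' i) ∧
        T i ≤ Function.update B j B' i := fun i => by
      by_cases hi : i = j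
      · subst hi; simpa using ⟨hB', hTB'⟩
      · simpa [hi] using ⟨hB i, hT i⟩
    have heq := hu _ (IsPairDesign.sum hR fun i => (hupd i).1)
      (Finset.sum_le_sum fun i _ => (hupd i).2)
    rw [Finset.sum_update_of_mem (Finset.mem_univ j),
      ← Finset.add_sum_erase _ B (Finset.mem_univ j), Finset.sdiff_singleton_eq_erase] at heq
    exact add_right_cancel heq

theorem of_isDD {B : Multiset (List α)} (hB : IsDD 2 4 1 B) (hss : SuperSimple B)
    (hdef : ∀ S, IsDefiningSet 2 4 1 B S → c * (Multiset.card B : ℝ) ≤ (Multiset.card S : ℝ)) :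
    HasSuperSimplePairDesign c (fun x y : α => x ≠ y) :=
  ⟨B, (isDD_two_four_one_iff B).1 hB, hss, fun S hS hu => hdef S
    ⟨hS, fun B' hB' hSB' => hu B' ((isDD_two_four_one_iff B').1 hB') hSB'⟩⟩

theorem exists_isDD (h : HasSuperSimplePairDesign c (fun x y : α => x ≠ y)) :
    ∃ B : Multiset (List α), IsDD 2 4 1 B ∧ SuperSimple B ∧
      ∀ S, IsDefiningSet 2 4 1 B S → c * (Multiset.card B : ℝ) ≤ (Multiset.card S : ℝ) := by
  obtain ⟨B, hB, hss, hdef⟩ := h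
  exact ⟨B, (isDD_two_four_one_iff B).2 hB, hss, fun S hS => hdef S hS.1
    fun B' hB' hSB' => hS.2 B' ((isDD_two_four_one_iff B').2 hB') hSB'⟩

theorem of_isDGDD {Gs : Multiset (Finset α)} {B : Multiset (List α)} (hB : IsDGDD Gs B)
    (hss : SuperSimple B)
    (hdef : ∀ S, IsDGDDDefiningSet Gs B S →
      c * (Multiset.card B : ℝ) ≤ (Multiset.card S : ℝ)) :
    HasSuperSimplePairDesign c (fun x y => ∀ G ∈ Gs, ¬(x ∈ G ∧ y ∈ G)) :=
  ⟨B, (isDGDD_iff hB.1 B).1 hB, hss, fun S hS hu => hdef S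
    ⟨hS, fun B' hB' hSB' => hu B' ((isDGDD_iff hB.1 B').1 hB') hSB'⟩⟩

end HasSuperSimplePairDesign

/-- The points of a partition into `k` groups of size `n` can be labelled by pairs whose first
coordinate, in a given `k`-set, determines the group. -/
theorem exists_equiv_prod_of_partition {α β : Type*} [Fintype α] {n : ℕ} {s : Finset β}
    {Gs : Multiset (Finset α)} (hα : Fintype.card α = n * s.card)
    (hGs : ∀ x : α, Gs.countP (fun G => x ∈ G) = 1) (hcard : Multiset.card Gs = s.card)
    (hn : ∀ G ∈ Gs, G.card = n) :
    ∃ e : α ≃ s × Fin n, ∀ x y, (∀ G ∈ Gs, ¬(x ∈ G ∧ y ∈ G)) ↔ (e x).1 ≠ (e y).1 := by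
  choose grp hgrp hgrp' using fun x => Multiset.existsUnique_of_countP_eq_one (hGs x)
  have e₁ : Gs ≃ s := Fintype.equivOfCardEq (by rw [Multiset.card_coe, hcard, Fintype.card_coe])
  have hmem : ∀ G : Gs, G.1 ∈ Gs := fun G => Multiset.coe_mem
  have e₂ : ∀ G : Gs, G.1 ≃ Fin n := fun G =>
    Fintype.equivOfCardEq (by rw [Fintype.card_coe, hn _ (hmem G), Fintype.card_fin])
  let f : α → s × Fin n := fun x => (e₁ (grp x), e₂ (grp x) ⟨x, hgrp x⟩)
  have hf : Function.Injective f := by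
    have key : ∀ x y : α, ∀ G H : Gs, ∀ (hx : x ∈ G.1) (hy : y ∈ H.1), G = H →
        e₂ G ⟨x, hx⟩ = e₂ H ⟨y, hy⟩ → x = y := by
      rintro x y G _ hx hy rfl h
      exact congrArg Subtype.val ((e₂ G).injective h)
    intro x y h
    exact key x y _ _ _ _ (e₁.injective (congrArg Prod.fst h)) (congrArg Prod.snd h)
  refine ⟨Equiv.ofBijective f ((Fintype.bijective_iff_injective_and_card f).2 ⟨hf, ?_⟩), ?_⟩
  · rw [hα, Fintype.card_prod, Fintype.card_coe, Fintype.card_fin, mul_comm]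
  · intro x y
    change _ ↔ e₁ (grp x) ≠ e₁ (grp y)
    rw [e₁.injective.ne_iff]
    constructor
    · exact fun h e => h _ (hmem (grp x)) ⟨hgrp x, e ▸ hgrp y⟩
    · rintro h G hG ⟨hx, hy⟩
      obtain ⟨i, rfl⟩ : ∃ i : Gs, i.1 = G :=
        ⟨⟨G, 0, Multiset.count_pos.2 hG⟩, rfl⟩
      exact h ((hgrp' x i hx).symm.trans (hgrp' y i hy))

/-- The pairs of distinct points lying in the weighted group `G` extended by the point `none`. -/
def WeightedGroupRel {β : Type*} {n : ℕ} (G : Finset β) (x y : Option (β × Fin n)) : Prop :=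
  x ≠ y ∧ (∀ p ∈ x, p.1 ∈ G) ∧ ∀ p ∈ y, p.1 ∈ G

/-- The pairs of points lying over distinct points of the block `b`. -/
def WeightedBlockRel {β : Type*} {n : ℕ} (b : Finset β) (x y : Option (β × Fin n)) : Prop :=
  ∃ p q, x = some p ∧ y = some q ∧ p.1 ∈ b ∧ q.1 ∈ b ∧ p.1 ≠ q.1

theorem hasSuperSimplePairDesign_weightedGroupRel {α β : Type*} [Fintype α] {c : ℝ} {n : ℕ}
    {G : Finset β} (hα : Fintype.card α = n * G.card + 1)
    (h : HasSuperSimplePairDesign c (fun x y : α => x ≠ y)) :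
    HasSuperSimplePairDesign c (WeightedGroupRel (n := n) G) := by
  let e : α ≃ Option (G × Fin n) := Fintype.equivOfCardEq (by simp [hα, mul_comm])
  let f : Option (G × Fin n) → Option (β × Fin n) := Option.map (Prod.map Subtype.val id)
  have hf : Function.Injective f :=
    Option.map_injective (Subtype.val_injective.prodMap Function.injective_id)
  have hmem : ∀ z, ∀ p ∈ f z, p.1 ∈ G := by
    rintro (_ | ⟨p, i⟩) q hq
    · simp [f] at hq
    · obtain rfl : (p.1, i) = q := by simpa [f] using hq
      exact p.2
  have hrange : ∀ z : Option (β × Fin n), (∀ p ∈ z, p.1 ∈ G) → z ∈ Set.range (f ∘ e) := by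
    intro z hz
    rw [e.surjective.range_comp]
    rcases z with _ | ⟨p, i⟩
    · exact ⟨none, rfl⟩
    · exact ⟨some (⟨p, hz _ rfl⟩, i), rfl⟩
  have hfe := hf.comp e.injective
  exact h.map hfe
    (fun a b => ⟨fun hab => ⟨hfe.ne hab, hmem _, hmem _⟩, fun hab => hfe.ne_iff.1 hab.1⟩)
    fun x y hxy => ⟨hrange x hxy.2.1, hrange y hxy.2.2⟩

theorem hasSuperSimplePairDesign_weightedBlockRel {α β : Type*} [Fintype α] {c : ℝ} {n : ℕ}
    {b : Finset β} {Gs : Multiset (Finset α)} (hα : Fintype.card α = n * b.card)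
    (hGs : ∀ x : α, Gs.countP (fun G => x ∈ G) = 1) (hcard : Multiset.card Gs = b.card)
    (hn : ∀ G ∈ Gs, G.card = n)
    (h : HasSuperSimplePairDesign c (fun x y => ∀ G ∈ Gs, ¬(x ∈ G ∧ y ∈ G))) :
    HasSuperSimplePairDesign c (WeightedBlockRel (n := n) b) := by
  obtain ⟨e, he⟩ := exists_equiv_prod_of_partition hα hGs hcard hn
  let f : α → Option (β × Fin n) := fun x => some (Prod.map Subtype.val id (e x))
  have hf : Function.Injective f := (Option.some_injective _).comp
    ((Subtype.val_injective.prodMap Function.injective_id).comp e.injective)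
  have hrange : ∀ p : β × Fin n, p.1 ∈ b → some p ∈ Set.range f := fun p hp =>
    ⟨e.symm (⟨p.1, hp⟩, p.2), by simp [f]⟩
  refine h.map hf (fun x y => ?_) ?_
  · rw [he]
    constructor
    · exact fun hne => ⟨_, _, rfl, rfl, (e x).1.2, (e y).1.2, fun heq => hne (Subtype.ext heq)⟩
    · rintro ⟨p, q, hp, hq, -, -, hne⟩ heq
      obtain rfl := Option.some_injective _ hp
      obtain rfl := Option.some_injective _ hq
      exact hne (congrArg Subtype.val heq)
  · rintro _ _ ⟨p, q, rfl, rfl, hp, hq, -⟩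
    exact ⟨hrange p hp, hrange q hq⟩

/-- In a weighted group divisible design, each pair of distinct points is covered by exactly one
extended group or block. -/
theorem IsGDD.existsUnique_weightedRel {β : Type*} {n : ℕ} {K : Set ℕ}
    {Gs Bs : Multiset (Finset β)} (h : IsGDD K Gs Bs) (x y : Option (β × Fin n)) (hxy : x ≠ y) :
    ∃! j : Gs ⊕ Bs, Sum.elim (fun G : Gs => WeightedGroupRel G.1 x y)
      (fun b : Bs => WeightedBlockRel b.1 x y) j := by
  obtain ⟨hG, -, hBG, hB⟩ := h
  have group_of : ∀ p : β × Fin n, (∀ q ∈ x, ∃ G ∈ Gs, q.1 ∈ G ∧ p.1 ∈ G) →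
      (∀ q ∈ y, ∃ G ∈ Gs, q.1 ∈ G ∧ p.1 ∈ G) → (x = some p ∨ y = some p) →
      (∀ b ∈ Bs, ¬ WeightedBlockRel b x y) →
      ∃! j : Gs ⊕ Bs, Sum.elim (fun G : Gs => WeightedGroupRel G.1 x y)
        (fun b : Bs => WeightedBlockRel b.1 x y) j := by
    intro p hx hy hp hb
    obtain ⟨G, hpG, hu⟩ := Multiset.existsUnique_of_countP_eq_one (hG p.1)
    have hsame : ∀ q : β × Fin n, (∃ H ∈ Gs, q.1 ∈ H ∧ p.1 ∈ H) → q.1 ∈ G.1 := by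
      rintro q ⟨H, hH, hq, hp⟩
      rwa [← hu ⟨H, 0, Multiset.count_pos.2 hH⟩ hp]
    refine ⟨Sum.inl G, ⟨hxy, fun q hq => hsame q (hx q hq), fun q hq => hsame q (hy q hq)⟩, ?_⟩
    rintro (H | b) hj
    · exact congrArg Sum.inl (hu H (hp.elim (fun e => hj.2.1 p e) fun e => hj.2.2 p e))
    · exact absurd hj (hb b.1 Multiset.coe_mem)
  have self : ∀ p : β × Fin n, ∃ G ∈ Gs, p.1 ∈ G ∧ p.1 ∈ G := fun p => by
    obtain ⟨G, hG, hp⟩ := Multiset.countP_pos.1 ((hG p.1).symm ▸ one_pos)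
    exact ⟨G, hG, hp, hp⟩
  rcases x with _ | p <;> rcases y with _ | q
  · exact absurd rfl hxy
  · refine group_of q (by simp) ?_ (Or.inr rfl) ?_
    · rintro _ ⟨⟩; exact self q
    · rintro b - ⟨_, _, ⟨⟩, -⟩
  · refine group_of p ?_ (by simp) (Or.inl rfl) ?_
    · rintro _ ⟨⟩; exact self p
    · rintro b - ⟨_, _, -, ⟨⟩, -⟩
  · by_cases hpq : ∀ G ∈ Gs, ¬(p.1 ∈ G ∧ q.1 ∈ G)
    · have hne : p.1 ≠ q.1 := fun e => by
        obtain ⟨G, hG, hp, -⟩ := self p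
        exact hpq G hG ⟨hp, e ▸ hp⟩
      obtain ⟨b, hb, hu⟩ := Multiset.existsUnique_of_countP_eq_one (hB p.1 q.1 hne hpq)
      refine ⟨Sum.inr b, ⟨p, q, rfl, rfl, hb.1, hb.2, hne⟩, ?_⟩
      rintro (G | b') hj
      · exact absurd ⟨hj.2.1 p rfl, hj.2.2 q rfl⟩ (hpq G.1 Multiset.coe_mem)
      · obtain ⟨_, _, ⟨⟩, ⟨⟩, hp, hq, -⟩ := hj
        exact congrArg Sum.inr (hu b' ⟨hp, hq⟩)
    · push Not at hpq
      obtain ⟨G, hGG, hp, hq⟩ := hpq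
      refine group_of p ?_ ?_ (Or.inl rfl) ?_
      · rintro _ ⟨⟩; exact self p
      · rintro _ ⟨⟩; exact ⟨G, hGG, hq, hp⟩
      · rintro b hb ⟨_, _, ⟨⟩, ⟨⟩, hpb, hqb, hne⟩
        exact hne (Finset.card_le_one.1 (hBG b hb G hGG) _ (Finset.mem_inter.2 ⟨hpb, hp⟩) _
          (Finset.mem_inter.2 ⟨hqb, hq⟩))

theorem IsGDD.hasSuperSimplePairDesign {β : Type*} {c : ℝ} {n : ℕ} {K : Set ℕ}
    {Gs Bs : Multiset (Finset β)} (h : IsGDD K Gs Bs)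
    (hgroup : ∀ G ∈ Gs, HasSuperSimplePairDesign c (WeightedGroupRel (n := n) G))
    (hblock : ∀ b ∈ Bs, HasSuperSimplePairDesign c (WeightedBlockRel (n := n) b)) :
    HasSuperSimplePairDesign c (fun x y : Option (β × Fin n) => x ≠ y) := by
  refine HasSuperSimplePairDesign.sum
    (R := fun (j : Gs ⊕ Bs) x y => Sum.elim (fun G : Gs => WeightedGroupRel G.1 x y)
      (fun b : Bs => WeightedBlockRel b.1 x y) j) ?_ h.existsUnique_weightedRel ?_
  · rintro (G | b) x y hj
    · exact ⟨hj.1.symm, hj.2.2, hj.2.1⟩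
    · obtain ⟨p, q, hp, hq, hpb, hqb, hne⟩ := hj
      exact ⟨q, p, hq, hp, hqb, hpb, hne.symm⟩
  · rintro (G | b)
    · exact hgroup G.1 Multiset.coe_mem
    · exact hblock b.1 Multiset.coe_mem

/-- Wilson's fundamental construction / weighting.  Given a
`{K}`-GDD of type `g₁^{u₁} ⋯ g_N^{u_N}`, super-simple `2-(α·gᵢ+1,4,1)DD`s and
super-simple `4`-DGDDs of type `α^k` (`k ∈ K`), each with every defining set of
size at least `c` times the number of blocks, there is a super-simple
`2-(α·∑ gᵢuᵢ + 1, 4, 1)DD` with the same property. -/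
theorem stmt4 (K : Set ℕ) (alpha : ℕ) (halpha : 0 < alpha) (c : ℝ) (hc : 0 ≤ c)
    (N : ℕ) (g u : Fin N → ℕ)
    (hGDD : ∃ Gs Bs : Multiset (Finset (Fin (∑ i, g i * u i))),
      IsGDD K Gs Bs ∧
      Gs.map Finset.card = ∑ i : Fin N, Multiset.replicate (u i) (g i))
    (hDD : ∀ i : Fin N, ∃ B : Multiset (List (Fin (alpha * g i + 1))),
      IsDD 2 4 1 B ∧ SuperSimple B ∧
      ∀ S, IsDefiningSet 2 4 1 B S →
        c * (Multiset.card B : ℝ) ≤ (Multiset.card S : ℝ))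
    (hDGDD : ∀ k ∈ K, ∃ (Gs : Multiset (Finset (Fin (alpha * k))))
        (B : Multiset (List (Fin (alpha * k)))),
      IsDGDD Gs B ∧ Multiset.card Gs = k ∧ (∀ G ∈ Gs, G.card = alpha) ∧
      SuperSimple B ∧
      ∀ S, IsDGDDDefiningSet Gs B S →
        c * (Multiset.card B : ℝ) ≤ (Multiset.card S : ℝ)) :
    ∃ B : Multiset (List (Fin (alpha * (∑ i, g i * u i) + 1))),
      IsDD 2 4 1 B ∧ SuperSimple B ∧
      ∀ S, IsDefiningSet 2 4 1 B S →
        c * (Multiset.card B : ℝ) ≤ (Multiset.card S : ℝ) := by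
  obtain ⟨Gs, Bs, hD, htype⟩ := hGDD
  have hgroup : ∀ G ∈ Gs, HasSuperSimplePairDesign c (WeightedGroupRel (n := alpha) G) := by
    intro G hG
    obtain ⟨i, hi⟩ : ∃ i, G.card = g i := by
      have := Multiset.mem_map_of_mem Finset.card hG
      rw [htype] at this
      obtain ⟨i, -, hi⟩ := Multiset.mem_sum.1 this
      exact ⟨i, Multiset.eq_of_mem_replicate hi⟩
    obtain ⟨B, hB, hss, hdef⟩ := hDD i
    exact hasSuperSimplePairDesign_weightedGroupRel (by rw [Fintype.card_fin, hi])
      (HasSuperSimplePairDesign.of_isDD hB hss hdef)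
  have hblock : ∀ b ∈ Bs, HasSuperSimplePairDesign c (WeightedBlockRel (n := alpha) b) := by
    intro b hb
    obtain ⟨Hs, B, hB, hcard, hn, hss, hdef⟩ := hDGDD b.card (hD.2.1 b hb)
    exact hasSuperSimplePairDesign_weightedBlockRel (Fintype.card_fin _) hB.1 hcard hn
      (HasSuperSimplePairDesign.of_isDGDD hB hss hdef)
  let e : Option (Fin (∑ i, g i * u i) × Fin alpha) ≃ Fin (alpha * (∑ i, g i * u i) + 1) :=
    Fintype.equivOfCardEq (by simp [mul_comm])
  exact ((hD.hasSuperSimplePairDesign hgroup hblock).map e.injective (fun a b => e.injective.ne_iff.symm)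
    fun x y _ => ⟨e.surjective x, e.surjective y⟩).exists_isDD
end

section
/- For every integer v ≥ 7, a super-simple 2-(v,4,1) directed design on a v-element point set exists if and only if v ≡ 1 (mod 3). -/
open scoped Classical

/-- A graph has a super-simple directed decomposition when its ordered adjacent pairs are
partitioned by directed `4`-cliques, any two of which share at most two points. -/
def HasSSD {α : Type} (G : SimpleGraph α) : Prop :=
  ∃ (ι : Type) (_ : Finite ι) (b : ι → Fin 4 → α),
    (∀ i p q, p ≠ q → G.Adj (b i p) (b i q)) ∧
    (∀ x y, G.Adj x y → ∃! i, ∃ p q, p < q ∧ b i p = x ∧ b i q = y) ∧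
    ∀ i j p q r p' q' r', p ≠ q → p ≠ r → q ≠ r →
      b i p = b j p' → b i q = b j q' → b i r = b j r' → i = j

theorem HasSSD.of_subsingleton {α : Type} [Subsingleton α] (G : SimpleGraph α) : HasSSD G :=
  ⟨Empty, inferInstance, fun i => i.elim, fun i => i.elim,
    fun x y h => (h.ne (Subsingleton.elim x y)).elim, fun i => i.elim⟩

/-- Super-simple directed decompositions of the parts of an edge decomposition glue together. -/
theorem HasSSD.glue {α κ : Type} [Finite κ] {β : κ → Type} {G : SimpleGraph α}
    {H : ∀ k, SimpleGraph (β k)} (f : ∀ k, β k → α)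
    (hf : ∀ k x y, (H k).Adj x y → G.Adj (f k x) (f k y))
    (hinj : ∀ k, Function.Injective (f k))
    (hcover : ∀ x y, G.Adj x y → ∃! k, ∃ x' y', (H k).Adj x' y' ∧ f k x' = x ∧ f k y' = y)
    (hH : ∀ k, HasSSD (H k)) : HasSSD G := by
  choose ι hι b hadj hpair hss using hH
  have hκ : ∀ (k k' : κ) (x y : β k) (x' y' : β k'), (H k).Adj x y → (H k').Adj x' y' →
      f k x = f k' x' → f k y = f k' y' → k = k' := fun k k' x y x' y' h h' hx hy =>
    (hcover _ _ (hf k x y h)).unique ⟨x, y, h, rfl, rfl⟩ ⟨x', y', h', hx.symm, hy.symm⟩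
  refine ⟨Σ k, ι k, inferInstance, fun i p => f i.1 (b i.1 i.2 p),
    fun i p q h => hf _ _ _ (hadj _ _ _ _ h), ?_, ?_⟩
  · intro x y hxy
    obtain ⟨k, ⟨x', y', h', rfl, rfl⟩, -⟩ := hcover x y hxy
    obtain ⟨i, ⟨p, q, hpq, rfl, rfl⟩, hi⟩ := hpair k x' y' h'
    refine ⟨⟨k, i⟩, ⟨p, q, hpq, rfl, rfl⟩, ?_⟩
    rintro ⟨k', i'⟩ ⟨p', q', hpq', hx, hy⟩
    dsimp only at hx hy
    obtain rfl := hκ _ _ _ _ _ _ (hadj k' i' p' q' hpq'.ne) h' hx hy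
    obtain rfl := hi i' ⟨p', q', hpq', hinj _ hx, hinj _ hy⟩
    rfl
  · rintro ⟨k, i⟩ ⟨k', i'⟩ p q r p' q' r' hpq hpr hqr hp hq hr
    dsimp only at hp hq hr
    have hpq' : p' ≠ q' := by
      rintro rfl
      exact (hf _ _ _ (hadj k i p q hpq)).ne (hp.trans hq.symm)
    obtain rfl := hκ _ _ _ _ _ _ (hadj k i p q hpq) (hadj k' i' p' q' hpq') hp hq
    obtain rfl := hss k i i' p q r p' q' r' hpq hpr hqr (hinj _ hp) (hinj _ hq) (hinj _ hr)
    rfl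

theorem HasSSD.of_iso {α β : Type} {G : SimpleGraph α} {H : SimpleGraph β} (e : H ≃g G)
    (h : HasSSD H) : HasSSD G :=
  HasSSD.glue (κ := Unit) (β := fun _ => β) (H := fun _ => H) (fun _ => e)
    (fun _ _ _ hxy => e.map_adj_iff.2 hxy) (fun _ => e.injective)
    (fun x y hxy => ⟨(), ⟨e.symm x, e.symm y, e.symm.map_adj_iff.2 hxy, by simp, by simp⟩,
      fun _ _ => rfl⟩) (fun _ => h)

/-- Develop base blocks under translation by the kernel of `φ`. -/
theorem hasSSD_of_base_blocks {A C K ι : Type} [AddCommGroup A] [Finite A] [AddCommGroup C]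
    [AddCommGroup K] [Finite ι] (φ : A →+ C) (ψ : A →+ K) (b : ι → Fin 4 → A)
    (hadj : ∀ i p q, p < q → ψ (b i q - b i p) ≠ 0)
    (hcover : ∀ x y, ψ (y - x) ≠ 0 →
      ∃ i p q, p < q ∧ φ (b i p) = φ x ∧ b i q - b i p = y - x)
    (huniq : ∀ i p q i' p' q', p < q → p' < q' → φ (b i p) = φ (b i' p') →
      b i q - b i p = b i' q' - b i' p' → i = i' ∧ p = p')
    (hrev : ∀ i p q r i' p' q' r', p < q → q < r → p' < q' → q' < r' →
      φ (b i p) = φ (b i' r') → b i q - b i p = b i' q' - b i' r' →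
      b i r - b i p ≠ b i' p' - b i' r') :
    HasSSD ((⊤ : SimpleGraph K).comap ψ) := by
  have hsame : ∀ (i j : ι) (s t : φ.ker) p q p' q', p < q → p' < q' →
      b i p + s = b j p' + t → b i q + s = b j q' + t → (i, s) = (j, t) := by
    intro i j s t p q p' q' hpq hpq' hp hq
    have hs : φ s = 0 := s.2
    have ht : φ t = 0 := t.2
    have hφ := congrArg φ hp
    rw [map_add, map_add, hs, ht, add_zero, add_zero] at hφ
    obtain ⟨rfl, rfl⟩ := huniq i p q j p' q' hpq hpq' hφ
      (by rw [← add_sub_add_right_eq_sub _ _ (s : A), hp, hq, add_sub_add_right_eq_sub])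
    rw [Prod.mk.injEq]
    exact ⟨rfl, Subtype.ext (add_left_cancel hp)⟩
  have hsorted : ∀ (i j : ι) (s t : φ.ker) p q r p' q' r', p < q → q < r →
      p' ≠ q' → q' ≠ r' →
      b i p + s = b j p' + t → b i q + s = b j q' + t → b i r + s = b j r' + t →
      (i, s) = (j, t) := by
    intro i j s t p q r p' q' r' hpq hqr hpq' hqr' hp hq hr
    rcases hpq'.lt_or_gt with h | h
    · exact hsame i j s t p q p' q' hpq h hp hq
    rcases hqr'.lt_or_gt with h' | h'
    · exact hsame i j s t q r q' r' hqr h' hq hr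
    have hs : φ s = 0 := s.2
    have ht : φ t = 0 := t.2
    have hφ := congrArg φ hp
    rw [map_add, map_add, hs, ht, add_zero, add_zero] at hφ
    refine (hrev i p q r j r' q' p' hpq hqr h' h hφ ?_ ?_).elim
    · rw [← add_sub_add_right_eq_sub _ _ (s : A), hp, hq, add_sub_add_right_eq_sub]
    · rw [← add_sub_add_right_eq_sub _ _ (s : A), hp, hr, add_sub_add_right_eq_sub]
  have hne : ∀ i p q, p ≠ q → b i p ≠ b i q := by
    intro i p q hpq h
    rcases hpq.lt_or_gt with h' | h'
    · exact hadj i p q h' (by rw [h, sub_self, map_zero])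
    · exact hadj i q p h' (by rw [h, sub_self, map_zero])
  refine ⟨ι × φ.ker, inferInstance, fun i p => b i.1 p + i.2, ?_, ?_, ?_⟩
  · rintro ⟨i, s⟩ p q hpq
    simp only [SimpleGraph.comap_adj, SimpleGraph.top_adj, map_add, ne_eq, add_left_inj]
    rcases hpq.lt_or_gt with h | h
    · intro h'
      exact hadj i p q h (by rw [map_sub, h', sub_self])
    · intro h'
      exact hadj i q p h (by rw [map_sub, h', sub_self])
  · intro x y hxy
    obtain ⟨i, p, q, hpq, hφ, hd⟩ := hcover x y fun h => hxy (by
      rw [map_sub, sub_eq_zero] at h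
      exact h.symm)
    have hs : φ (x - b i p) = 0 := by rw [map_sub, hφ, sub_self]
    have hx : b i p + (x - b i p) = x := by abel
    have hy : b i q + (x - b i p) = y := by
      rw [← sub_add_cancel y x, ← hd]
      abel
    refine ⟨(i, ⟨_, hs⟩), ⟨p, q, hpq, hx, hy⟩, ?_⟩
    rintro ⟨j, t⟩ ⟨p', q', hpq', hx', hy'⟩
    exact hsame j i t ⟨_, hs⟩ p' q' p q hpq' hpq (hx'.trans hx.symm) (hy'.trans hy.symm)
  · rintro ⟨i, s⟩ ⟨j, t⟩ p q r p' q' r' hpq hpr hqr hp hq hr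
    dsimp only at hp hq hr
    have hne' : ∀ u v u' v', u ≠ v → b i u + s = b j u' + t → b i v + s = b j v' + t →
        u' ≠ v' := by
      rintro u v u' v' huv hu hv rfl
      exact hne i u v huv (add_right_cancel (hu.trans hv.symm))
    have hpq' := hne' p q p' q' hpq hp hq
    have hpr' := hne' p r p' r' hpr hp hr
    have hqr' := hne' q r q' r' hqr hq hr
    rcases hpq.lt_or_gt with h1 | h1 <;> rcases hpr.lt_or_gt with h2 | h2 <;>
      rcases hqr.lt_or_gt with h3 | h3
    · exact hsorted i j s t p q r p' q' r' h1 h3 hpq' hqr' hp hq hr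
    · exact hsorted i j s t p r q p' r' q' h2 h3 hpr' hqr'.symm hp hr hq
    · exact (lt_asymm (h1.trans h3) h2).elim
    · exact hsorted i j s t r p q r' p' q' h2 h1 hpr'.symm hpq' hr hp hq
    · exact hsorted i j s t q p r q' p' r' h1 h2 hpq'.symm hpr' hq hp hr
    · exact (lt_asymm (h3.trans h1) h2).elim
    · exact hsorted i j s t q r p q' r' p' h3 h2 hqr' hpr'.symm hq hr hp
    · exact hsorted i j s t r q p r' q' p' h3 h1 hqr'.symm hpq'.symm hr hq hp

/-- The invariant of the ordered pair `(x, y)` in `ZMod N` under translation by multiples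
of `m`. -/
def pairKey (N m x y : ℕ) : ℕ × ℕ := (x % m, (y + (N - 1) * x) % N)

/-- The invariants of the ordered pairs appearing in a block. -/
def pairKeys (N m : ℕ) (b : Fin 4 → ℕ) : List (ℕ × ℕ) :=
  [(0, 1), (0, 2), (0, 3), (1, 2), (1, 3), (2, 3)].map
    fun p : Fin 4 × Fin 4 => pairKey N m (b p.1) (b p.2)

/-- The invariant of an ordered triple in `ZMod N` under translation by multiples of `m`. -/
def tripleKey (N m x y z : ℕ) : (ℕ × ℕ) × ℕ := (pairKey N m x y, (z + (N - 1) * x) % N)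

/-- The invariants of the ordered triples appearing in a block. -/
def tripleKeys (N m : ℕ) (b : Fin 4 → ℕ) : List ((ℕ × ℕ) × ℕ) :=
  [(0, 1, 2), (0, 1, 3), (0, 2, 3), (1, 2, 3)].map
    fun p : Fin 4 × Fin 4 × Fin 4 => tripleKey N m (b p.1) (b p.2.1) (b p.2.2)

/-- The invariants of the ordered triples appearing in the reversal of a block. -/
def revTripleKeys (N m : ℕ) (b : Fin 4 → ℕ) : List ((ℕ × ℕ) × ℕ) :=
  [(0, 1, 2), (0, 1, 3), (0, 2, 3), (1, 2, 3)].map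
    fun p : Fin 4 × Fin 4 × Fin 4 => tripleKey N m (b p.2.2) (b p.2.1) (b p.1)

/-- The blocks of `L`, developed in `ZMod N` by translation by multiples of `m`, form a
super-simple directed decomposition of the complete multipartite graph on the residue classes
modulo `k`. -/
def IsBase (N m k : ℕ) (L : List (Fin 4 → ℕ)) : Prop :=
  (L.flatMap (pairKeys N m)).Nodup ∧
    (∀ e ∈ L.flatMap (pairKeys N m), e.2 % k ≠ 0) ∧
    (∀ r < m, ∀ d < N, d % k ≠ 0 → (r, d) ∈ L.flatMap (pairKeys N m)) ∧
    ∀ e ∈ L.flatMap (tripleKeys N m), e ∉ L.flatMap (revTripleKeys N m)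

instance (N m k : ℕ) (L : List (Fin 4 → ℕ)) : Decidable (IsBase N m k L) := by
  unfold IsBase
  infer_instance

theorem pairKey_eq_iff {N m : ℕ} (hN : 0 < N) {x y x' y' : ℕ} :
    pairKey N m x y = pairKey N m x' y' ↔
      (x : ZMod m) = x' ∧ (y : ZMod N) - x = y' - x' := by
  have hcast : ∀ x y : ℕ, ((y + (N - 1) * x : ℕ) : ZMod N) = y - x := by
    intro x y
    push_cast [Nat.cast_sub (Nat.succ_le_of_lt hN)]
    rw [ZMod.natCast_self]
    ring
  rw [pairKey, pairKey, Prod.mk.injEq, ← hcast, ← hcast, ZMod.natCast_eq_natCast_iff,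
    ZMod.natCast_eq_natCast_iff]
  rfl

theorem tripleKey_eq_iff {N m : ℕ} (hN : 0 < N) {x y z x' y' z' : ℕ} :
    tripleKey N m x y z = tripleKey N m x' y' z' ↔
      (x : ZMod m) = x' ∧ (y : ZMod N) - x = y' - x' ∧ (z : ZMod N) - x = z' - x' := by
  have h := @pairKey_eq_iff N m hN x y x' y'
  have h' := @pairKey_eq_iff N 1 hN x z x' z'
  simp only [pairKey, Nat.mod_one, Prod.mk.injEq, true_and] at h'
  rw [tripleKey, tripleKey, Prod.mk.injEq, h, h', and_assoc]
  simp [Subsingleton.elim (x : ZMod 1) x']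

theorem mem_pairs_of_lt : ∀ p q : Fin 4, p < q →
    (p, q) ∈ [((0 : Fin 4), (1 : Fin 4)), (0, 2), (0, 3), (1, 2), (1, 3), (2, 3)] := by
  decide

theorem lt_of_mem_pairs : ∀ p q : Fin 4,
    (p, q) ∈ [((0 : Fin 4), (1 : Fin 4)), (0, 2), (0, 3), (1, 2), (1, 3), (2, 3)] → p < q := by
  decide

theorem mem_triples_of_lt : ∀ p q r : Fin 4, p < q → q < r →
    (p, q, r) ∈ [((0 : Fin 4), (1 : Fin 4), (2 : Fin 4)), (0, 1, 3), (0, 2, 3), (1, 2, 3)] := by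
  decide

theorem IsBase.hasSSD {N m k : ℕ} {L : List (Fin 4 → ℕ)} (hN : 0 < N) (hm : m ∣ N) (hk : k ∣ N)
    (h : IsBase N m k L) :
    HasSSD ((⊤ : SimpleGraph (ZMod k)).comap (ZMod.castHom hk (ZMod k))) := by
  obtain ⟨hnd, hadj, hcover, hrev⟩ := h
  rw [List.nodup_flatMap] at hnd
  obtain ⟨hnd, hdisj⟩ := hnd
  have : NeZero N := ⟨hN.ne'⟩
  have hm0 : 0 < m := Nat.pos_of_dvd_of_pos hm hN
  have hmem : ∀ (b : Fin 4 → ℕ) p q, p < q →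
      pairKey N m (b p) (b q) ∈ pairKeys N m b := fun b p q hpq =>
    List.mem_map.2 ⟨(p, q), mem_pairs_of_lt p q hpq, rfl⟩
  have : Finite {b // b ∈ L} := (List.finite_toSet L).to_subtype
  have hmod : ∀ a : ℕ, ZMod.castHom hk (ZMod k) ((a : ZMod N)) = 0 ↔ a % k = 0 := by
    intro a
    rw [map_natCast, ZMod.natCast_eq_zero_iff, Nat.dvd_iff_mod_eq_zero]
  have hdiff : ∀ x y : ℕ, (((pairKey N m x y).2 : ℕ) : ZMod N) = y - x := by
    intro x y
    rw [pairKey, ZMod.natCast_mod]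
    push_cast [Nat.cast_sub (Nat.succ_le_of_lt hN)]
    rw [ZMod.natCast_self]
    ring
  refine hasSSD_of_base_blocks (ι := {b // b ∈ L}) (ZMod.castHom hm (ZMod m)).toAddMonoidHom
    (ZMod.castHom hk (ZMod k)).toAddMonoidHom (fun b p => (b.1 p : ZMod N)) ?_ ?_ ?_ ?_
  · rintro ⟨b, hb⟩ p q hpq h0
    refine hadj _ (List.mem_flatMap.2 ⟨b, hb, hmem b p q hpq⟩) ?_
    rw [← hmod, hdiff]
    exact h0
  · intro x y hxy
    have hd : (((y - x).val : ℕ) : ZMod N) = y - x := ZMod.natCast_zmod_val _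
    obtain ⟨b, hb, hkey⟩ := List.mem_flatMap.1 (hcover (x.val % m) (Nat.mod_lt _ hm0)
      (y - x).val (ZMod.val_lt _) (by rwa [ne_eq, ← hmod, hd]))
    obtain ⟨⟨p, q⟩, hpq, hkey⟩ := List.mem_map.1 hkey
    refine ⟨⟨b, hb⟩, p, q, lt_of_mem_pairs p q hpq, ?_, ?_⟩
    · have h1 : b p % m = x.val % m := congrArg Prod.fst hkey
      have h2 : ((b p : ℕ) : ZMod m) = (x.val : ℕ) := (ZMod.natCast_eq_natCast_iff _ _ _).2 h1
      change ZMod.castHom hm (ZMod m) _ = ZMod.castHom hm (ZMod m) x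
      rw [← ZMod.natCast_zmod_val x, map_natCast, map_natCast, h2]
    · have h1 := congrArg Prod.snd hkey
      dsimp only at h1 ⊢
      rw [← hd, ← h1, hdiff]
  · rintro ⟨b, hb⟩ p q ⟨b', hb'⟩ p' q' hpq hpq' hφ hd
    dsimp only at hφ hd
    have hkey : pairKey N m (b p) (b q) = pairKey N m (b' p') (b' q') := by
      refine (pairKey_eq_iff hN).2 ⟨?_, hd⟩
      simpa using hφ
    have hbb : b = b' := by
      by_contra hne
      have : Std.Symm (Function.onFun List.Disjoint (pairKeys N m)) := ⟨fun _ _ h => h.symm⟩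
      exact hdisj.forall hb hb' hne (hmem b p q hpq) (hkey ▸ hmem b' p' q' hpq')
    subst hbb
    have := List.inj_on_of_nodup_map (hnd b hb) (mem_pairs_of_lt p q hpq)
      (mem_pairs_of_lt p' q' hpq') hkey
    exact ⟨rfl, congrArg Prod.fst this⟩
  · rintro ⟨b, hb⟩ p q r ⟨b', hb'⟩ p' q' r' hpq hqr hpq' hqr' hφ h1 h2
    dsimp only at hφ h1 h2
    have hkey : tripleKey N m (b p) (b q) (b r) = tripleKey N m (b' r') (b' q') (b' p') := by
      refine (tripleKey_eq_iff hN).2 ⟨?_, h1, h2⟩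
      simpa using hφ
    refine hrev _ (List.mem_flatMap.2 ⟨b, hb, List.mem_map.2
      ⟨(p, q, r), mem_triples_of_lt p q r hpq hqr, rfl⟩⟩) ?_
    dsimp only
    rw [hkey]
    exact List.mem_flatMap.2 ⟨b', hb', List.mem_map.2
      ⟨(p', q', r'), mem_triples_of_lt p' q' r' hpq' hqr', rfl⟩⟩

theorem HasSSD.top_of_card {α β : Type} [Finite α] [Finite β] (h : Nat.card α = Nat.card β)
    (hα : HasSSD (⊤ : SimpleGraph α)) : HasSSD (⊤ : SimpleGraph β) :=
  HasSSD.of_iso (SimpleGraph.Iso.completeGraph ((Finite.card_eq.1 h).some)) hα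

/-- The complete multipartite graph with one part of size `3` for each element of `C`. -/
abbrev threeParts (C : Type) : SimpleGraph (C × Fin 3) := (⊤ : SimpleGraph C).comap Prod.fst

theorem card_fiber_fst {C K : Type} (e : C ≃ K) (c : K) :
    Nat.card {x : C × Fin 3 // e x.1 = c} = 3 := by
  have e' : {x : C × Fin 3 // e x.1 = c} ≃ Fin 3 :=
    { toFun := fun x => x.1.2
      invFun := fun i => ⟨(e.symm c, i), by simp⟩
      left_inv := by
        rintro ⟨⟨d, i⟩, rfl⟩
        simp
      right_inv := fun i => rfl }
  rw [Nat.card_congr e', Nat.card_fin]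

theorem HasSSD.threeParts_of_fibers {A C : Type} {K : Type} [Finite C] [Finite K] [Finite A]
    (ψ : A → K) (hcard : Nat.card C = Nat.card K)
    (hψ : ∀ c, Nat.card {a // ψ a = c} = 3) (h : HasSSD ((⊤ : SimpleGraph K).comap ψ)) :
    HasSSD (threeParts C) := by
  let e : C ≃ K := (Finite.card_eq.1 hcard).some
  let E : A ≃ C × Fin 3 := Equiv.ofFiberEquiv (f := ψ) (g := fun x => e x.1)
    fun c => (Finite.card_eq.1 ((hψ c).trans (card_fiber_fst e c).symm)).some
  have hE : ∀ a, e (E a).1 = ψ a := fun a =>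
    Equiv.ofFiberEquiv_map (g := fun x : C × Fin 3 => e x.1) _ a
  refine HasSSD.of_iso ⟨E, ?_⟩ h
  intro a a'
  simp only [SimpleGraph.comap_adj, SimpleGraph.top_adj, ne_eq, ← hE, e.injective.eq_iff]

theorem IsBase.threeParts {k m : ℕ} [NeZero k] {L : List (Fin 4 → ℕ)} (h : IsBase (3 * k) m k L)
    (hm : m ∣ 3 * k)
    (hfib : ∀ c : ZMod k,
      Fintype.card {a // ZMod.castHom (Dvd.intro_left 3 rfl : k ∣ 3 * k) (ZMod k) a = c} = 3) :
    HasSSD (threeParts (Fin k)) :=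
  HasSSD.threeParts_of_fibers _ (by simp)
    (fun c => (Nat.card_eq_fintype_card (α := {a // _ = c})).trans (hfib c))
    (h.hasSSD (Nat.mul_pos (by decide) (NeZero.pos k)) hm _)

/-- There is a super-simple directed design on `3 * n + 1` points. -/
def GoodSize (n : ℕ) : Prop := HasSSD (⊤ : SimpleGraph (Fin (3 * n + 1)))

theorem IsBase.goodSize {n m : ℕ} {L : List (Fin 4 → ℕ)}
    (h : IsBase (3 * n + 1) m (3 * n + 1) L) (hm : m ∣ 3 * n + 1) : GoodSize n := by
  have h' := h.hasSSD (Nat.succ_pos _) hm dvd_rfl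
  rw [ZMod.castHom_self] at h'
  exact HasSSD.top_of_card (by simp) (HasSSD.of_iso (H := SimpleGraph.comap _ ⊤)
    (G := (⊤ : SimpleGraph (ZMod (3 * n + 1)))) ⟨Equiv.refl _, by simp⟩ h')

theorem goodSize_zero : GoodSize 0 :=
  have : Subsingleton (Fin (3 * 0 + 1)) := inferInstanceAs (Subsingleton (Fin 1))
  HasSSD.of_subsingleton _

/-- Wilson's construction from a transversal design `L` whose columns are truncated to the
subsets `A c`, with weight `3` and one point at infinity. -/
theorem goodSize_of_transversal {k : ℕ} {M : Type} [Finite M] (L : M × M → Fin k → M)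
    (hL : ∀ c c', c ≠ c' → ∀ x y, ∃! u, L u c = x ∧ L u c' = y)
    (A : Fin k → Finset M) (hA : ∀ c, GoodSize (A c).card)
    (hblock : ∀ u, HasSSD (threeParts {c // L u c ∈ A c})) : GoodSize (∑ c, (A c).card) := by
  let P := Option ((Σ c, A c) × Fin 3)
  suffices h : HasSSD (⊤ : SimpleGraph P) by
    refine h.top_of_card ?_
    simp [P, mul_comm]
  let β : Fin k ⊕ (M × M) → Type := Sum.elim (fun c => Option (A c × Fin 3))
    fun u => {c // L u c ∈ A c} × Fin 3
  let H : ∀ κ, SimpleGraph (β κ) := fun κ => match κ with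
    | .inl _ => ⊤
    | .inr _ => threeParts _
  let f : ∀ κ, β κ → P := fun κ => match κ with
    | .inl c => Option.map fun x => (⟨c, x.1⟩, x.2)
    | .inr u => fun x => some (⟨x.1.1, ⟨L u x.1.1, x.1.2⟩⟩, x.2)
  have hinj : ∀ κ, Function.Injective (f κ) := by
    rintro (c | u)
    · refine Option.map_injective ?_
      rintro ⟨x, i⟩ ⟨y, j⟩ h
      simpa using h
    · rintro ⟨⟨c, hc⟩, i⟩ ⟨⟨d, hd⟩, j⟩ h
      have h := Prod.ext_iff.1 (Option.some_injective _ h)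
      simp only [Sigma.mk.injEq] at h
      obtain ⟨⟨rfl, -⟩, rfl⟩ := h
      rfl
  have hcol : ∀ (c d : Fin k) (x : A c) (y : A d) (i j : Fin 3),
      (some (⟨c, x⟩, i) : P) = some (⟨d, y⟩, j) → c = d := fun c d x y i j h =>
    congrArg (fun z => z.1.1) (Option.some_injective _ h)
  refine HasSSD.glue (H := H) f ?_ hinj ?_ ?_
  · intro κ x y hxy
    rw [SimpleGraph.top_adj]
    exact (hinj κ).ne hxy.ne
  · have hgroup : ∀ c (x y : Option (A c × Fin 3)), x ≠ y → ∀ κ x' y', (H κ).Adj x' y' →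
        f κ x' = f (.inl c) x → f κ y' = f (.inl c) y → κ = .inl c := by
      rintro c x y hxy (d | u) x' y' hadj hx hy
      · rcases x with - | ⟨x, i⟩
        · rcases y with - | ⟨y, j⟩
          · exact (hxy rfl).elim
          · rcases y' with - | ⟨y', j'⟩
            · exact absurd hy (by simp [f])
            · rw [hcol _ _ _ _ _ _ hy]
        · rcases x' with - | ⟨x', j'⟩
          · exact absurd hx (by simp [f])
          · rw [hcol _ _ _ _ _ _ hx]
      · obtain ⟨⟨d, hd⟩, i⟩ := x'
        obtain ⟨⟨d', hd'⟩, i'⟩ := y'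
        rcases x with - | ⟨x, j⟩
        · exact absurd hx (by simp [f])
        rcases y with - | ⟨y, j'⟩
        · exact absurd hy (by simp [f])
        exact (hadj (Subtype.ext ((hcol _ _ _ _ _ _ hx).trans (hcol _ _ _ _ _ _ hy).symm))).elim
    intro x y hxy
    have hsame : ∀ c (x' y' : Option (A c × Fin 3)), f (.inl c) x' = x → f (.inl c) y' = y →
        ∃! κ, ∃ x' y', (H κ).Adj x' y' ∧ f κ x' = x ∧ f κ y' = y := by
      rintro c x' y' rfl rfl
      have hne : x' ≠ y' := fun h => hxy (by rw [h])
      refine ⟨.inl c, ⟨x', y', hne, rfl, rfl⟩, ?_⟩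
      rintro κ ⟨x'', y'', hadj, hx, hy⟩
      exact hgroup c x' y' hne κ x'' y'' hadj hx hy
    rcases x with - | ⟨⟨c, x⟩, i⟩
    · rcases y with - | ⟨⟨d, y⟩, j⟩
      · exact (hxy rfl).elim
      · exact hsame d none (some (y, j)) rfl rfl
    rcases y with - | ⟨⟨d, y⟩, j⟩
    · exact hsame c (some (x, i)) none rfl rfl
    by_cases hcd : c = d
    · subst hcd
      exact hsame c (some (x, i)) (some (y, j)) rfl rfl
    obtain ⟨x, hx⟩ := x
    obtain ⟨y, hy⟩ := y
    obtain ⟨u, ⟨rfl, rfl⟩, hu⟩ := hL c d hcd x y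
    refine ⟨.inr u, ⟨(⟨c, hx⟩, i), (⟨d, hy⟩, j), fun h => hcd (congrArg Subtype.val h),
      rfl, rfl⟩, ?_⟩
    rintro (e | w) ⟨x', y', hadj, hx', hy'⟩
    · rcases x' with - | ⟨x', i'⟩
      · exact absurd hx' (by simp [f])
      rcases y' with - | ⟨y', j'⟩
      · exact absurd hy' (by simp [f])
      exact (hcd ((hcol _ _ _ _ _ _ hx').symm.trans (hcol _ _ _ _ _ _ hy'))).elim
    · obtain ⟨⟨c', hc'⟩, i'⟩ := x'
      obtain ⟨⟨d', hd'⟩, j'⟩ := y'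
      have h1 := congrArg Prod.fst (Option.some_injective _ hx')
      have h2 := congrArg Prod.fst (Option.some_injective _ hy')
      simp only [Sigma.mk.injEq] at h1 h2
      obtain ⟨rfl, h1⟩ := h1
      obtain ⟨rfl, h2⟩ := h2
      rw [hu w ⟨congrArg Subtype.val (eq_of_heq h1), congrArg Subtype.val (eq_of_heq h2)⟩]
  · rintro (c | u)
    · refine HasSSD.top_of_card (β := Option (A c × Fin 3)) ?_ (hA c)
      simp [mul_comm]
    · exact hblock u

/-- The transversal design over `ZMod m` with one vertical and `n` sloped columns. -/
def slopeLine {n m : ℕ} (u : ZMod m × ZMod m) : Fin (n + 1) → ZMod m :=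
  Fin.cons u.2 fun c : Fin n => u.1 + (c : ℕ) * u.2

theorem existsUnique_slopeLine {n m : ℕ} (hm : ∀ d, 0 < d → d < n → Nat.Coprime d m)
    (c c' : Fin (n + 1)) (hc : c ≠ c') (x y : ZMod m) :
    ∃! u : ZMod m × ZMod m, slopeLine u c = x ∧ slopeLine u c' = y := by
  have hvert : ∀ (c : Fin n) (x y : ZMod m),
      ∃! u : ZMod m × ZMod m, u.2 = x ∧ u.1 + (c : ℕ) * u.2 = y := by
    intro c x y
    refine ⟨(y - (c : ℕ) * x, x), ⟨rfl, by ring⟩, ?_⟩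
    rintro ⟨a, b⟩ ⟨h1, h2⟩
    dsimp only at h1 h2
    subst h1
    rw [← h2, add_sub_cancel_right]
  have hslope : ∀ (c c' : Fin n) (x y : ZMod m), c < c' →
      ∃! u : ZMod m × ZMod m, u.1 + (c : ℕ) * u.2 = x ∧ u.1 + (c' : ℕ) * u.2 = y := by
    intro c c' x y hcc
    obtain ⟨d, hd⟩ := Nat.exists_eq_add_of_lt (Fin.lt_def.1 hcc)
    have hinv : ((d + 1 : ℕ) : ZMod m) * ((d + 1 : ℕ) : ZMod m)⁻¹ = 1 :=
      ZMod.coe_mul_inv_eq_one _ (hm _ (Nat.succ_pos d) (by omega))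
    have hc' : ((c' : ℕ) : ZMod m) = (c : ℕ) + ((d + 1 : ℕ) : ZMod m) := by
      rw [hd]
      push_cast
      ring
    rw [hc']
    generalize ((d + 1 : ℕ) : ZMod m) = e at hinv
    refine ⟨(x - (c : ℕ) * (e⁻¹ * (y - x)), e⁻¹ * (y - x)), ⟨by ring, ?_⟩, ?_⟩
    · linear_combination (y - x) * hinv
    · rintro ⟨a, b⟩ ⟨h1, h2⟩
      dsimp only at h1 h2
      have hb : b = e⁻¹ * (y - x) := by
        rw [← h1, ← h2]
        linear_combination -b * hinv
      rw [← hb, ← h1, add_sub_cancel_right]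
  refine Fin.cases ?_ (fun i => ?_) c (motive := fun c => c ≠ c' → ∃! u : ZMod m × ZMod m,
    slopeLine u c = x ∧ slopeLine u c' = y) hc <;>
  refine Fin.cases ?_ (fun j => ?_) c'
  · exact fun h => (h rfl).elim
  · exact fun _ => hvert j x y
  · intro _
    obtain ⟨u, hu, h⟩ := hvert i y x
    exact ⟨u, hu.symm, fun w hw => h w hw.symm⟩
  · intro hij
    rcases (show i ≠ j from fun h => hij (congrArg _ h)).lt_or_gt with h | h
    · exact hslope i j x y h
    · obtain ⟨u, hu, h⟩ := hslope j i y x h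
      exact ⟨u, hu.symm, fun w hw => h w hw.symm⟩

theorem goodSize_sum {n m : ℕ} [NeZero m] (hm : ∀ d, 0 < d → d < n → Nat.Coprime d m)
    (hparts : ∀ k, 4 ≤ k → k ≤ n + 1 → HasSSD (threeParts (Fin k)))
    (size : Fin (n + 1) → ℕ) (hfull : ∃ S : Finset (Fin (n + 1)), S.card = 4 ∧ ∀ c ∈ S, size c = m)
    (hle : ∀ c, size c ≤ m) (hgood : ∀ c, GoodSize (size c)) : GoodSize (∑ c, size c) := by
  have hex : ∀ c, ∃ A : Finset (ZMod m), A.card = size c := fun c => by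
    obtain ⟨A, -, hA⟩ := Finset.exists_subset_card_eq (s := (Finset.univ : Finset (ZMod m)))
      (n := size c) (by rw [Finset.card_univ, ZMod.card]; exact hle c)
    exact ⟨A, hA⟩
  choose A hA using hex
  simp only [← hA] at hgood ⊢
  refine goodSize_of_transversal slopeLine (existsUnique_slopeLine hm) A hgood fun u => ?_
  obtain ⟨S, hS, hfull⟩ := hfull
  have hAS : ∀ c ∈ S, A c = Finset.univ := fun c hc =>
    Finset.eq_univ_of_card _ (by rw [hA, hfull c hc, ZMod.card])
  have hcard : Nat.card {c // slopeLine u c ∈ A c} =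
      (Finset.univ.filter fun c => slopeLine u c ∈ A c).card := by
    rw [Nat.card_eq_fintype_card, Fintype.card_subtype]
  have h4 : 4 ≤ Nat.card {c // slopeLine u c ∈ A c} := by
    rw [hcard, ← hS]
    exact Finset.card_le_card fun c hc =>
      Finset.mem_filter.2 ⟨Finset.mem_univ c, by rw [hAS c hc]; exact Finset.mem_univ _⟩
  have hn : Nat.card {c // slopeLine u c ∈ A c} ≤ n + 1 := by
    rw [hcard]
    exact (Finset.card_le_univ _).trans_eq (Fintype.card_fin _)
  exact HasSSD.threeParts_of_fibers (Prod.fst : Fin _ × Fin 3 → _) (by simp)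
    (card_fiber_fst (Equiv.refl _)) (hparts _ h4 hn)

theorem goodSize_two : GoodSize 2 :=
  IsBase.goodSize (m := 1) (L :=
      [![0, 5, 2, 1]])
    (by decide +kernel) (by decide)

theorem goodSize_three : GoodSize 3 :=
  IsBase.goodSize (m := 2) (L :=
      [![0, 2, 9, 6], ![0, 5, 1, 3], ![1, 5, 6, 4]])
    (by decide +kernel) (by decide)

theorem goodSize_four : GoodSize 4 :=
  IsBase.goodSize (m := 1) (L :=
      [![0, 7, 4, 5], ![0, 6, 9, 8]])
    (by decide +kernel) (by decide)

theorem goodSize_five : GoodSize 5 :=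
  IsBase.goodSize (m := 2) (L :=
      [![1, 0, 13, 4], ![1, 10, 6, 12], ![0, 15, 3, 5], ![0, 10, 11, 8], ![1, 2, 11, 9]])
    (by decide +kernel) (by decide)

theorem goodSize_six : GoodSize 6 :=
  IsBase.goodSize (m := 1) (L :=
      [![0, 3, 13, 17], ![0, 16, 9, 8], ![0, 6, 2, 7]])
    (by decide +kernel) (by decide)

theorem goodSize_seven : GoodSize 7 :=
  IsBase.goodSize (m := 2) (L :=
      [![0, 1, 3, 2], ![1, 11, 19, 17], ![0, 19, 4, 12], ![1, 18, 12, 10], ![1, 20, 13, 4],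
        ![0, 10, 17, 21], ![0, 13, 18, 5]])
    (by decide +kernel) (by decide)

theorem goodSize_eight : GoodSize 8 :=
  IsBase.goodSize (m := 1) (L :=
      [![0, 13, 6, 10], ![0, 1, 17, 15], ![0, 2, 9, 5], ![0, 24, 11, 19]])
    (by decide +kernel) (by decide)

theorem goodSize_nine : GoodSize 9 :=
  IsBase.goodSize (m := 2) (L :=
      [![0, 4, 27, 11], ![1, 12, 21, 18], ![0, 2, 22, 18], ![1, 27, 6, 14], ![1, 2, 23, 3],
        ![0, 26, 12, 17], ![1, 5, 15, 24], ![0, 10, 25, 13], ![1, 7, 25, 0]])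
    (by decide +kernel) (by decide)

theorem goodSize_ten : GoodSize 10 :=
  IsBase.goodSize (m := 1) (L :=
      [![0, 16, 21, 8], ![0, 22, 10, 25], ![0, 17, 14, 13], ![0, 6, 26, 7], ![0, 24, 4, 2]])
    (by decide +kernel) (by decide)

theorem goodSize_eleven : GoodSize 11 :=
  IsBase.goodSize (m := 2) (L :=
      [![1, 13, 27, 11], ![0, 33, 2, 26], ![1, 9, 6, 26], ![0, 14, 25, 29], ![0, 4, 22, 16],
        ![1, 31, 3, 16], ![0, 31, 8, 21], ![1, 0, 10, 17], ![1, 2, 21, 8], ![0, 30, 1, 23],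
        ![0, 9, 3, 32]])
    (by decide +kernel) (by decide)

theorem goodSize_twelve : GoodSize 12 :=
  IsBase.goodSize (m := 1) (L :=
      [![0, 23, 31, 22], ![0, 15, 2, 18], ![0, 13, 27, 33], ![0, 11, 9, 30], ![0, 32, 5, 12],
        ![0, 25, 29, 26]])
    (by decide +kernel) (by decide)

theorem goodSize_thirteen : GoodSize 13 :=
  IsBase.goodSize (m := 2) (L :=
      [![0, 18, 16, 20], ![0, 24, 33, 13], ![0, 6, 32, 23], ![1, 39, 11, 35], ![1, 36, 3, 4],
        ![1, 33, 23, 8], ![1, 18, 15, 14], ![1, 19, 6, 7], ![1, 22, 32, 27], ![0, 11, 19, 30],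
        ![0, 22, 25, 34], ![0, 39, 28, 15], ![1, 24, 5, 38]])
    (by decide +kernel) (by decide)

theorem goodSize_fourteen : GoodSize 14 :=
  IsBase.goodSize (m := 1) (L :=
      [![0, 29, 24, 16], ![0, 26, 4, 40], ![0, 7, 5, 20], ![0, 10, 22, 18], ![0, 27, 9, 3],
        ![0, 6, 23, 34], ![0, 32, 31, 33]])
    (by decide +kernel) (by decide)

theorem goodSize_fifteen : GoodSize 15 :=
  IsBase.goodSize (m := 2) (L :=
      [![0, 44, 38, 27], ![0, 15, 21, 36], ![1, 39, 4, 0], ![0, 45, 12, 19], ![0, 33, 24, 3],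
        ![1, 43, 9, 40], ![0, 37, 17, 39], ![0, 16, 30, 4], ![1, 33, 15, 34],
        ![1, 26, 36, 37], ![0, 23, 32, 41], ![1, 28, 25, 30], ![0, 18, 26, 31],
        ![1, 42, 18, 24], ![1, 11, 41, 45]])
    (by decide +kernel) (by decide)

theorem goodSize_sixteen : GoodSize 16 :=
  IsBase.goodSize (m := 1) (L :=
      [![0, 43, 11, 16], ![0, 48, 26, 1], ![0, 20, 38, 34], ![0, 6, 31, 15], ![0, 46, 4, 41],
        ![0, 21, 8, 40], ![0, 35, 47, 28], ![0, 23, 3, 13]])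
    (by decide +kernel) (by decide)

theorem goodSize_seventeen : GoodSize 17 :=
  IsBase.goodSize (m := 2) (L :=
      [![1, 25, 12, 8], ![0, 29, 28, 22], ![0, 5, 43, 14], ![0, 8, 27, 25], ![1, 26, 49, 9],
        ![1, 4, 42, 30], ![0, 3, 16, 9], ![0, 20, 15, 51], ![0, 33, 12, 1], ![0, 6, 13, 50],
        ![1, 41, 17, 35], ![1, 28, 18, 15], ![1, 11, 33, 2], ![1, 3, 45, 50], ![0, 36, 21, 2],
        ![1, 5, 20, 31], ![0, 24, 4, 34]])
    (by decide +kernel) (by decide)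

theorem goodSize_eighteen : GoodSize 18 :=
  IsBase.goodSize (m := 1) (L :=
      [![0, 49, 11, 15], ![0, 16, 5, 24], ![0, 2, 12, 37], ![0, 51, 9, 42], ![0, 39, 27, 34],
        ![0, 1, 54, 31], ![0, 52, 45, 26], ![0, 22, 28, 14], ![0, 20, 38, 23]])
    (by decide +kernel) (by decide)

theorem goodSize_nineteen : GoodSize 19 :=
  IsBase.goodSize (m := 2) (L :=
      [![1, 41, 8, 49], ![1, 57, 33, 22], ![0, 17, 37, 22], ![0, 34, 39, 30], ![0, 1, 11, 12],
        ![0, 40, 7, 49], ![0, 56, 44, 31], ![1, 14, 20, 46], ![1, 0, 10, 3], ![1, 5, 32, 17],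
        ![0, 57, 14, 29], ![1, 45, 15, 51], ![1, 36, 52, 56], ![1, 4, 39, 27],
        ![0, 21, 2, 38], ![0, 24, 52, 42], ![0, 55, 50, 19], ![0, 53, 47, 13],
        ![1, 55, 30, 38]])
    (by decide +kernel) (by decide)

theorem goodSize_twentyOne : GoodSize 21 :=
  IsBase.goodSize (m := 2) (L :=
      [![0, 16, 62, 47], ![1, 7, 18, 57], ![1, 26, 17, 29], ![1, 36, 43, 25], ![1, 52, 9, 28],
        ![1, 31, 3, 34], ![0, 15, 22, 28], ![0, 34, 8, 35], ![0, 30, 18, 10], ![0, 4, 54, 33],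
        ![0, 12, 25, 23], ![1, 39, 30, 62], ![1, 45, 38, 55], ![1, 2, 21, 53],
        ![1, 22, 27, 6], ![1, 5, 50, 0], ![1, 42, 23, 41], ![1, 59, 48, 10], ![0, 20, 61, 57],
        ![1, 40, 35, 49], ![0, 24, 2, 60]])
    (by decide +kernel) (by decide)

theorem hasSSD_threeParts_four : HasSSD (threeParts (Fin 4)) :=
  IsBase.threeParts (m := 4) (L :=
      [![0, 5, 11, 2], ![2, 9, 7, 4], ![1, 2, 0, 3], ![3, 8, 9, 2], ![3, 10, 1, 4],
        ![0, 10, 7, 9]])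
    (by decide +kernel) (by decide) (by decide +kernel)

theorem hasSSD_threeParts_five : HasSSD (threeParts (Fin 5)) :=
  IsBase.threeParts (m := 1) (L :=
      [![0, 3, 11, 2], ![0, 12, 4, 13]])
    (by decide +kernel) (by decide) (by decide +kernel)

theorem hasSSD_threeParts_six : HasSSD (threeParts (Fin 6)) :=
  IsBase.threeParts (m := 2) (L :=
      [![1, 4, 3, 17], ![0, 11, 1, 10], ![0, 3, 14, 16], ![1, 2, 6, 11], ![1, 8, 16, 5]])
    (by decide +kernel) (by decide) (by decide +kernel)

theorem hasSSD_threeParts_seven : HasSSD (threeParts (Fin 7)) :=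
  IsBase.threeParts (m := 1) (L :=
      [![0, 16, 10, 12], ![0, 1, 19, 6], ![0, 11, 20, 3]])
    (by decide +kernel) (by decide) (by decide +kernel)

theorem exists_threeParts {k : ℕ} (h4 : 4 ≤ k) (h7 : k ≤ 7) : HasSSD (threeParts (Fin k)) := by
  interval_cases k
  exacts [hasSSD_threeParts_four, hasSSD_threeParts_five, hasSSD_threeParts_six,
    hasSSD_threeParts_seven]

theorem goodSize_of_coprime_six {m u : ℕ} (hm : Nat.Coprime 6 m) (hm5 : 5 ≤ m)
    (h4 : 4 * m ≤ u) (h6 : u ≤ 6 * m) (hne : u ≠ 4 * m + 1)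
    (ih : ∀ w, 2 ≤ w → w ≤ m → GoodSize w) : GoodSize u := by
  obtain ⟨s, t, hs, ht, hs1, ht1, rfl⟩ : ∃ s t, s ≤ m ∧ t ≤ m ∧ s ≠ 1 ∧ t ≠ 1 ∧
      u = m + m + m + m + s + t := by
    rcases le_or_gt u (5 * m) with h | h
    · exact ⟨u - 4 * m, 0, by omega, by omega, by omega, by omega, by omega⟩
    · rcases eq_or_ne u (5 * m + 1) with h' | h'
      · exact ⟨m - 1, 2, by omega, by omega, by omega, by omega, by omega⟩
      · exact ⟨m, u - 5 * m, by omega, by omega, by omega, by omega, by omega⟩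
  have : NeZero m := ⟨by omega⟩
  have hgood : ∀ w, w ≤ m → w ≠ 1 → GoodSize w := by
    intro w hw hw1
    rcases Nat.eq_zero_or_pos w with rfl | h0
    · exact goodSize_zero
    · exact ih w (by omega) hw
  have h2 : Nat.Coprime 2 m := hm.coprime_dvd_left (by decide)
  have h3 : Nat.Coprime 3 m := hm.coprime_dvd_left (by decide)
  have hcop : ∀ d, 0 < d → d < 5 → Nat.Coprime d m := by
    intro d h0 h5
    interval_cases d
    · exact Nat.coprime_one_left m
    · exact h2
    · exact h3
    · exact h2.mul_left h2
  have hsum := goodSize_sum (n := 5) (m := m) hcop (fun k h h' => exists_threeParts h (by omega))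
    ![m, m, m, m, s, t] ⟨{0, 1, 2, 3}, rfl, by simp⟩
    (by simp [Fin.forall_fin_succ, hs, ht])
    (by simp [Fin.forall_fin_succ, hgood m le_rfl (by omega), hgood s hs hs1, hgood t ht ht1])
  simpa [Fin.sum_univ_succ, add_assoc] using hsum

theorem goodSize_of_seven (s t : ℕ) (hs : s ≤ 7) (ht : t ≤ 7) (hs' : GoodSize s)
    (ht' : GoodSize t) : GoodSize (35 + s + t) := by
  have hcop : ∀ d, 0 < d → d < 6 → Nat.Coprime d 7 := by
    intro d h0 h6
    interval_cases d <;> decide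
  have hsum := goodSize_sum (n := 6) (m := 7) hcop (fun k h h' => exists_threeParts h (by omega))
    ![7, 7, 7, 7, 7, s, t] ⟨{0, 1, 2, 3}, rfl, by simp⟩
    (by simp [Fin.forall_fin_succ, hs, ht])
    (by simp [Fin.forall_fin_succ, goodSize_seven, hs', ht'])
  convert hsum using 1
  simp [Fin.sum_univ_succ]
  ring

theorem goodSize_of_two_le (u : ℕ) (hu : 2 ≤ u) : GoodSize u := by
  induction u using Nat.strong_induction_on with
  | _ u ih =>
    have hstep : ∀ m, Nat.Coprime 6 m → 5 ≤ m → 4 * m ≤ u → u ≤ 6 * m → u ≠ 4 * m + 1 →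
        GoodSize u := fun m hm hm5 h4 h6 hne =>
      goodSize_of_coprime_six hm hm5 h4 h6 hne fun w hw hwm => ih w (by omega) hw
    rcases lt_or_ge u 20 with h | h
    · interval_cases u
      exacts [goodSize_two, goodSize_three, goodSize_four, goodSize_five, goodSize_six,
        goodSize_seven, goodSize_eight, goodSize_nine, goodSize_ten, goodSize_eleven,
        goodSize_twelve, goodSize_thirteen, goodSize_fourteen, goodSize_fifteen,
        goodSize_sixteen, goodSize_seventeen, goodSize_eighteen, goodSize_nineteen]
    rcases eq_or_ne u 21 with rfl | h21
    · exact goodSize_twentyOne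
    rcases eq_or_ne u 43 with rfl | h43
    · exact goodSize_of_seven 6 2 (by decide) (by decide) goodSize_six goodSize_two
    rcases eq_or_ne u 45 with rfl | h45
    · exact goodSize_of_seven 6 4 (by decide) (by decide) goodSize_six goodSize_four
    rcases le_or_gt u 30 with h30 | h30
    · exact hstep 5 (by decide) (by omega) (by omega) (by omega) (by omega)
    rcases le_or_gt u 42 with h42 | h42
    · exact hstep 7 (by decide) (by omega) (by omega) (by omega) (by omega)
    rcases le_or_gt u 66 with h66 | h66
    · exact hstep 11 (by decide) (by omega) (by omega) (by omega) (by omega)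
    rcases le_or_gt u 78 with h78 | h78
    · exact hstep 13 (by decide) (by omega) (by omega) (by omega) (by omega)
    · refine hstep (6 * (((u + 5) / 6 + 4) / 6) + 1) ?_ (by omega) (by omega) (by omega) (by omega)
      simp

theorem pair_sublist_iff {α : Type*} {x y a b c d : α} :
    [x, y].Sublist [a, b, c, d] ↔ (x = a ∧ (y = b ∨ y = c ∨ y = d)) ∨
      (x = b ∧ (y = c ∨ y = d)) ∨ (x = c ∧ y = d) := by
  simp only [List.cons_sublist_cons', or_false, List.sublist_nil, reduceCtorEq, false_or,
    and_false]
  tauto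

theorem HasSSD.exists_isDD {α : Type} (h : HasSSD (⊤ : SimpleGraph α)) :
    ∃ B : Multiset (List α), IsDD 2 4 1 B ∧ SuperSimple B := by
  obtain ⟨ι, _, b, hadj, hpair, hss⟩ := h
  have := Fintype.ofFinite ι
  have hne : ∀ i p q, p ≠ q → b i p ≠ b i q := fun i p q h => (hadj i p q h).ne
  have hsub : ∀ i x y, [x, y].Sublist (List.ofFn (b i)) ↔
      ∃ p q, p < q ∧ b i p = x ∧ b i q = y := by
    intro i x y
    simp only [List.ofFn_succ, List.ofFn_zero, pair_sublist_iff, Fin.exists_fin_succ]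
    simp [Fin.lt_def, eq_comm]
    tauto
  have hinj : Function.Injective fun i => List.ofFn (b i) := by
    intro i j hij
    have h01 : ∃ p q, p < q ∧ b i p = b i 0 ∧ b i q = b i 1 := ⟨0, 1, by decide, rfl, rfl⟩
    refine (hpair (b i 0) (b i 1) (hadj i 0 1 (by decide))).unique h01 ?_
    rw [← hsub] at h01 ⊢
    dsimp only at hij
    rwa [← hij]
  refine ⟨(Finset.univ : Finset ι).val.map fun i => List.ofFn (b i), ⟨?_, ?_⟩, ?_⟩
  · intro l hl
    obtain ⟨i, -, rfl⟩ := Multiset.mem_map.1 hl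
    refine ⟨List.nodup_ofFn.2 fun p q hpq => ?_, List.length_ofFn⟩
    by_contra hne'
    exact hne i p q hne' hpq
  · intro s hs hlen
    obtain ⟨x, y, rfl⟩ := List.length_eq_two.1 hlen
    have hxy : x ≠ y := by simpa using hs
    obtain ⟨i, hi, huniq⟩ := hpair x y hxy
    rw [Multiset.countP_map, ← Finset.filter_val, Finset.card_val, Finset.card_eq_one]
    refine ⟨i, Finset.ext fun j => ?_⟩
    rw [Finset.mem_filter, Finset.mem_singleton, hsub]
    exact ⟨fun h => huniq j h.2, fun h => ⟨Finset.mem_univ j, h ▸ hi⟩⟩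
  · intro l l' hle
    have hnd := Multiset.nodup_of_le hle (Finset.univ.nodup.map hinj)
    obtain ⟨i, -, rfl⟩ := Multiset.mem_map.1 (Multiset.mem_of_le hle (by simp : l ∈ {l, l'}))
    obtain ⟨j, -, rfl⟩ := Multiset.mem_map.1 (Multiset.mem_of_le hle (by simp : l' ∈ {_, l'}))
    by_contra hcard
    obtain ⟨x, hx, y, hy, z, hz, hxy, hxz, hyz⟩ := Finset.two_lt_card.1 (not_le.1 hcard)
    simp only [Finset.mem_inter, List.mem_toFinset, List.mem_ofFn'] at hx hy hz
    obtain ⟨⟨p, rfl⟩, p', hp⟩ := hx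
    obtain ⟨⟨q, rfl⟩, q', hq⟩ := hy
    obtain ⟨⟨r, rfl⟩, r', hr⟩ := hz
    have hij := hss i j p q r p' q' r' (fun h => hxy (h ▸ rfl)) (fun h => hxz (h ▸ rfl))
      (fun h => hyz (h ▸ rfl)) hp.symm hq.symm hr.symm
    subst hij
    simp at hnd

theorem three_dvd_sum_countP {α : Type*} [Fintype α] (x : α) (B : Multiset (List α))
    (hB : ∀ b ∈ B, IsBlock 4 b) :
    3 ∣ ∑ y ∈ Finset.univ.erase x, (B.countP (fun b => [x, y].Sublist b) +
      B.countP (fun b => [y, x].Sublist b)) := by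
  induction B using Multiset.induction_on with
  | empty => simp
  | cons l B ih =>
    have ih := ih fun b hb => hB b (Multiset.mem_cons_of_mem hb)
    have hl := hB l (Multiset.mem_cons_self l B)
    simp only [Multiset.countP_cons]
    rw [Finset.sum_congr rfl fun y _ => add_add_add_comm _ _ _ _, Finset.sum_add_distrib]
    refine dvd_add ih ?_
    obtain ⟨hnd, hlen⟩ := hl
    have hterm : ∀ y ∈ Finset.univ.erase x, ((if [x, y].Sublist l then 1 else 0) +
        if [y, x].Sublist l then 1 else 0) = if x ∈ l ∧ y ∈ l then 1 else 0 := by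
      intro y hy
      have hyx : y ≠ x := Finset.ne_of_mem_erase hy
      obtain ⟨a, b, c, d, rfl⟩ : ∃ a b c d, l = [a, b, c, d] := by
        match l, hlen with
        | [a, b, c, d], _ => exact ⟨a, b, c, d, rfl⟩
      simp only [pair_sublist_iff, List.mem_cons, List.not_mem_nil, or_false]
      simp only [List.nodup_cons, List.mem_cons, List.not_mem_nil, or_false, not_or] at hnd
      split_ifs <;> grind
    rw [Finset.sum_congr rfl hterm]
    by_cases hx : x ∈ l
    · have hfilter : (Finset.univ.erase x).filter (fun y => y ∈ l) = l.toFinset.erase x := by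
        ext y
        simp
      simp only [hx, true_and]
      rw [← Finset.card_filter, hfilter, Finset.card_erase_of_mem (List.mem_toFinset.2 hx),
        List.toFinset_card_of_nodup hnd, hlen]
    · simp [hx]

theorem IsDD.card_mod_three {α : Type*} [Fintype α] [Nonempty α] {B : Multiset (List α)}
    (hB : IsDD 2 4 1 B) : Fintype.card α % 3 = 1 := by
  obtain ⟨x⟩ := ‹Nonempty α›
  have h := three_dvd_sum_countP x B hB.1
  have hcount : ∀ x y : α, x ≠ y → B.countP (fun b => [x, y].Sublist b) = 1 :=
    fun x y hxy => hB.2 [x, y] (by simpa using hxy) rfl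
  have hsum : ∀ y ∈ Finset.univ.erase x, B.countP (fun b => [x, y].Sublist b) +
      B.countP (fun b => [y, x].Sublist b) = 2 := fun y hy => by
    rw [hcount _ _ (Finset.ne_of_mem_erase hy).symm, hcount _ _ (Finset.ne_of_mem_erase hy)]
  rw [Finset.sum_congr rfl hsum, Finset.sum_const, Finset.card_erase_of_mem (Finset.mem_univ _),
    Finset.card_univ, smul_eq_mul] at h
  have := Fintype.card_pos_iff.2 ⟨x⟩
  omega

/-- For every `v ≥ 7`, a super-simple `2-(v,4,1)DD` on a
`v`-element point set exists iff `v ≡ 1 (mod 3)`. -/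
theorem stmt5 (v : ℕ) (hv : 7 ≤ v) :
    (∃ B : Multiset (List (Fin v)), IsDD 2 4 1 B ∧ SuperSimple B) ↔ v % 3 = 1 := by
  constructor
  · rintro ⟨B, hB, -⟩
    have : Nonempty (Fin v) := ⟨⟨0, by omega⟩⟩
    simpa using hB.card_mod_three
  · intro h
    obtain ⟨u, rfl⟩ : ∃ u, v = 3 * u + 1 := ⟨v / 3, by omega⟩
    exact HasSSD.exists_isDD (goodSize_of_two_le u (by omega))
end
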